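/- arXiv:2501.19387 — 2 statements merged into one kernel-verified Lean document; each statement's English description precedes it below -/
import Mathlib

section
/- Let B and C be rational numbers with C ≠ 0, B ∉ {0, 1}, (C, B) ≠ (1, -1), and B^k·C^ℓ ∉ {1, -1} for all integers k ≠ 0 and all integers ℓ. Then there exist infinitely many primes r, coprime to both B and C, such that for all k ∈ ℤ, C^k ≢ B (mod r). -/
open Filter Topology NumberField IsDedekindDomain Asymptotics

section NumberField

variable (K : Type*) [Field K] [NumberField K]

theorem summable_absNorm_rpow_and_tsum_eq {s : ℝ} (hs : 1 < s) :
    Summable (fun I : Ideal (𝓞 K) ↦ (Ideal.absNorm I : ℝ) ^ (-s)) ∧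
      ((∑' I : Ideal (𝓞 K), (Ideal.absNorm I : ℝ) ^ (-s) : ℝ) : ℂ) = dedekindZeta K s := by
  have hO : (fun n : ℕ ↦ ∑ k ∈ Finset.Icc 1 n,
      (Nat.card {I : Ideal (𝓞 K) // Ideal.absNorm I = k} : ℝ)) =O[atTop]
        fun n : ℕ ↦ (n : ℝ) ^ (1 : ℝ) := by
    apply isBigO_atTop_natCast_rpow_of_tendsto_div_rpow (a := dedekindZeta_residue K)
    refine ((Ideal.tendsto_norm_le_div_atTop₀ K).comp tendsto_natCast_atTop_atTop).congr fun n ↦ ?_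
    simp only [Function.comp_apply, Nat.cast_le, ← Nat.cast_sum, Real.rpow_one]
    congr
    rw [← add_left_inj 1, ← Ideal.card_norm_le_eq_card_norm_le_add_one,
      show Finset.Icc 1 n = Finset.Ioc 0 n from Finset.Icc_succ_left_eq_Ioc _ _,
      show 1 = Nat.card {I : Ideal (𝓞 K) // Ideal.absNorm I = 0} by
        simp [Ideal.absNorm_eq_zero_iff],
      Finset.sum_Ioc_add_eq_sum_Icc (n.zero_le),
      ← Finset.card_preimage_eq_sum_card_image_eq (fun k _ ↦ Ideal.finite_setOfPred_absNorm_eq k)]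
    simp [Set.coe_eq_subtype]
  have hL := LSeriesSummable_of_sum_norm_bigO_and_nonneg hO (fun _ ↦ Nat.cast_nonneg _)
    zero_le_one (s := (s : ℂ)) (by simpa using hs)
  have hterm : ∀ n : ℕ, LSeries.term (fun n ↦ ((Nat.card {I : Ideal (𝓞 K) //
      Ideal.absNorm I = n} : ℝ) : ℂ)) s n =
      (((Nat.card {I : Ideal (𝓞 K) // Ideal.absNorm I = n} : ℝ) * (n : ℝ) ^ (-s) : ℝ) : ℂ) := by
    intro n
    rcases eq_or_ne n 0 with rfl | hn
    · simp [Real.zero_rpow (by linarith : -s ≠ 0)]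
    · rw [LSeries.term_of_ne_zero hn, Complex.ofReal_mul, Complex.ofReal_cpow (by positivity),
        Complex.ofReal_neg, Complex.cpow_neg, div_eq_mul_inv, Complex.ofReal_natCast]
      simp
  have hsum : Summable fun n : ℕ ↦
      (Nat.card {I : Ideal (𝓞 K) // Ideal.absNorm I = n} : ℝ) * (n : ℝ) ^ (-s) := by
    rw [← Complex.summable_ofReal]
    exact hL.congr hterm
  have hfib : ∀ n : ℕ, HasSum (fun c : {I : Ideal (𝓞 K) // Ideal.absNorm I = n} ↦
      (Ideal.absNorm (c : Ideal (𝓞 K)) : ℝ) ^ (-s))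
      ((Nat.card {I : Ideal (𝓞 K) // Ideal.absNorm I = n} : ℝ) * (n : ℝ) ^ (-s)) := by
    intro n
    have : Finite {I : Ideal (𝓞 K) // Ideal.absNorm I = n} := Ideal.finite_setOfPred_absNorm_eq n
    have := Fintype.ofFinite {I : Ideal (𝓞 K) // Ideal.absNorm I = n}
    have h := hasSum_fintype (fun c : {I : Ideal (𝓞 K) // Ideal.absNorm I = n} ↦
      (Ideal.absNorm (c : Ideal (𝓞 K)) : ℝ) ^ (-s))
    rw [Finset.sum_congr rfl (fun c _ ↦ by rw [c.2]), Finset.sum_const, nsmul_eq_mul,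
      Finset.card_univ, ← Nat.card_eq_fintype_card] at h
    exact h
  have hsig : Summable (fun x : (Σ n : ℕ, {I : Ideal (𝓞 K) // Ideal.absNorm I = n}) ↦
      (Ideal.absNorm (x.2 : Ideal (𝓞 K)) : ℝ) ^ (-s)) := by
    rw [summable_sigma_of_nonneg (fun _ ↦ by positivity)]
    exact ⟨fun n ↦ (hfib n).summable, hsum.congr fun n ↦ ((hfib n).tsum_eq).symm⟩
  constructor
  · rw [← (Equiv.sigmaFiberEquiv (fun I : Ideal (𝓞 K) ↦ Ideal.absNorm I)).summable_iff]
    exact hsig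
  · rw [← (Equiv.sigmaFiberEquiv (fun I : Ideal (𝓞 K) ↦ Ideal.absNorm I)).tsum_eq]
    change ((∑' x : (Σ n : ℕ, {I : Ideal (𝓞 K) // Ideal.absNorm I = n}),
      (Ideal.absNorm (x.2 : Ideal (𝓞 K)) : ℝ) ^ (-s) : ℝ) : ℂ) = _
    rw [hsig.tsum_sigma, tsum_congr fun n ↦ (hfib n).tsum_eq, Complex.ofReal_tsum]
    exact tsum_congr fun n ↦ by rw [← hterm]; simp

theorem isBigO_log_tsum_absNorm_add_log :
    (fun s : ℝ ↦ Real.log (∑' I : Ideal (𝓞 K), (Ideal.absNorm I : ℝ) ^ (-s)) + Real.log (s - 1))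
      =O[𝓝[>] 1] (fun _ ↦ (1 : ℝ)) := by
  have h1 : Tendsto (fun s : ℝ ↦ (s - 1) * ∑' I : Ideal (𝓞 K), (Ideal.absNorm I : ℝ) ^ (-s))
      (𝓝[>] 1) (𝓝 (dedekindZeta_residue K)) := by
    have := (Complex.continuous_re.tendsto _).comp (tendsto_sub_one_mul_dedekindZeta_nhdsGT K)
    rw [Complex.ofReal_re] at this
    refine this.congr' ?_
    filter_upwards [self_mem_nhdsWithin] with s hs
    simp only [Function.comp_apply]
    rw [← (summable_absNorm_rpow_and_tsum_eq K hs).2, ← Complex.ofReal_one, ← Complex.ofReal_sub,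
      ← Complex.ofReal_mul, Complex.ofReal_re]
  have h2 := h1.log (dedekindZeta_residue_ne_zero K)
  refine (h2.isBigO_one ℝ).congr' ?_ EventuallyEq.rfl
  filter_upwards [self_mem_nhdsWithin,
    h1.eventually_ne (dedekindZeta_residue_ne_zero K)] with s hs hne
  have hs' : s - 1 ≠ 0 := (sub_pos.2 hs).ne'
  rw [Real.log_mul hs' (right_ne_zero_of_mul hne), add_comm]

omit [NumberField K] in
theorem heightOneSpectrum_asIdeal_injective :
    Function.Injective (fun v : HeightOneSpectrum (𝓞 K) ↦ v.asIdeal) :=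
  fun _ _ h ↦ HeightOneSpectrum.ext h

theorem summable_heightOneSpectrum_absNorm_rpow {s : ℝ} (hs : 1 < s) :
    Summable (fun v : HeightOneSpectrum (𝓞 K) ↦ (Ideal.absNorm v.asIdeal : ℝ) ^ (-s)) :=
  (summable_absNorm_rpow_and_tsum_eq K hs).1.comp_injective (heightOneSpectrum_asIdeal_injective K)

variable {K} in
theorem two_le_absNorm (v : HeightOneSpectrum (𝓞 K)) : 2 ≤ Ideal.absNorm v.asIdeal := by
  have h0 : Ideal.absNorm v.asIdeal ≠ 0 := by
    rw [Ne, Ideal.absNorm_eq_zero_iff]; exact v.ne_bot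
  have h1 : Ideal.absNorm v.asIdeal ≠ 1 := by
    rw [Ne, Ideal.absNorm_eq_one_iff]; exact v.isPrime.ne_top
  omega

variable {K} in
theorem absNorm_rpow_le_half (v : HeightOneSpectrum (𝓞 K)) {s : ℝ} (hs : 1 ≤ s) :
    (Ideal.absNorm v.asIdeal : ℝ) ^ (-s) ≤ 1 / 2 := by
  have h2 : (2 : ℝ) ≤ Ideal.absNorm v.asIdeal := by exact_mod_cast two_le_absNorm v
  calc (Ideal.absNorm v.asIdeal : ℝ) ^ (-s) ≤ (Ideal.absNorm v.asIdeal : ℝ) ^ (-1 : ℝ) :=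
        Real.rpow_le_rpow_of_exponent_le (by linarith) (by linarith)
    _ = (Ideal.absNorm v.asIdeal : ℝ)⁻¹ := Real.rpow_neg_one _
    _ ≤ 1 / 2 := by
        rw [one_div]
        exact inv_anti₀ (by norm_num) h2

theorem absNorm_prod_rpow {ι : Type*} (T : Finset ι) (f : ι → Ideal (𝓞 K)) (s : ℝ) :
    (Ideal.absNorm (∏ i ∈ T, f i) : ℝ) ^ s = ∏ i ∈ T, (Ideal.absNorm (f i) : ℝ) ^ s := by
  rw [map_prod, Nat.cast_prod, Real.finsetProd_rpow _ _ (fun _ _ ↦ Nat.cast_nonneg _)]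

theorem prod_one_add_absNorm_rpow_le_tsum (T : Finset (HeightOneSpectrum (𝓞 K))) {s : ℝ}
    (hs : 1 < s) :
    ∏ v ∈ T, (1 + (Ideal.absNorm v.asIdeal : ℝ) ^ (-s)) ≤
      ∑' I : Ideal (𝓞 K), (Ideal.absNorm I : ℝ) ^ (-s) := by
  classical
  have hinj : Function.Injective
      (fun U : Finset (HeightOneSpectrum (𝓞 K)) ↦ ∏ v ∈ U, v.asIdeal) := by
    intro U W h
    have key : ∀ (U : Finset (HeightOneSpectrum (𝓞 K))) (v : HeightOneSpectrum (𝓞 K)),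
        v.asIdeal ∣ ∏ w ∈ U, w.asIdeal ↔ v ∈ U := by
      intro U v
      constructor
      · intro hd
        obtain ⟨w, hw, hvw⟩ := (v.prime.dvd_finsetProd_iff _).1 hd
        have : v = w := HeightOneSpectrum.ext
          (w.isMaximal.eq_of_le v.isPrime.ne_top (Ideal.dvd_iff_le.1 hvw)).symm
        exact this ▸ hw
      · exact fun hv ↦ Finset.dvd_prod_of_mem _ hv
    ext v
    rw [← key U, ← key W]
    exact iff_of_eq (congrArg _ h)
  rw [Finset.prod_one_add]
  calc ∑ U ∈ T.powerset, ∏ v ∈ U, (Ideal.absNorm v.asIdeal : ℝ) ^ (-s)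
      = ∑ I ∈ T.powerset.image (fun U ↦ ∏ v ∈ U, v.asIdeal), (Ideal.absNorm I : ℝ) ^ (-s) := by
        rw [Finset.sum_image hinj.injOn]
        exact Finset.sum_congr rfl fun U _ ↦ (absNorm_prod_rpow K _ _ _).symm
    _ ≤ _ := (summable_absNorm_rpow_and_tsum_eq K hs).1.sum_le_tsum _ (fun _ _ ↦ by positivity)

theorem sum_absNorm_rpow_le_prod (F : Finset (Ideal (𝓞 K))) {s : ℝ} (hs : 1 < s) :
    ∃ T : Finset (HeightOneSpectrum (𝓞 K)), ∑ I ∈ F, (Ideal.absNorm I : ℝ) ^ (-s) ≤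
      ∏ v ∈ T, (1 - (Ideal.absNorm v.asIdeal : ℝ) ^ (-s))⁻¹ := by
  classical
  let e : Ideal (𝓞 K) → HeightOneSpectrum (𝓞 K) → ℕ := fun I v ↦ multiplicity v.asIdeal I
  have hfin : ∀ I : Ideal (𝓞 K), ∃ T : Finset (HeightOneSpectrum (𝓞 K)), I ≠ ⊥ →
      ∀ T', T ⊆ T' → ∏ v ∈ T', v.asIdeal ^ e I v = I := by
    intro I
    by_cases hI : I = ⊥
    · exact ⟨∅, fun h ↦ absurd hI h⟩
    have hf : (Function.mulSupport fun v : HeightOneSpectrum (𝓞 K) ↦ v.asIdeal ^ e I v).Finite := by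
      have := Ideal.hasFiniteMulSupport hI
      simp only [HeightOneSpectrum.maxPowDividing_eq_pow_multiplicity hI] at this
      exact this
    refine ⟨hf.toFinset, fun _ T' hT' ↦ ?_⟩
    rw [← finprod_eq_prod_of_mulSupport_subset _
      (fun v hv ↦ Finset.mem_coe.2 (hT' (hf.mem_toFinset.2 hv)))]
    exact Ideal.finprod_heightOneSpectrum_pow_multiplicity hI
  choose t ht using hfin
  let T := F.biUnion t
  let m := ∑ I ∈ F, ∑ v ∈ T, e I v
  refine ⟨T, ?_⟩
  have hmem : ∀ I ∈ F.filter (· ≠ ⊥), I ∈ (Fintype.piFinset fun _ : T ↦ Finset.range (m + 1)).image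
      (fun a ↦ ∏ v : T, v.1.asIdeal ^ a v) := by
    intro I hI
    obtain ⟨hIF, hI0⟩ := Finset.mem_filter.1 hI
    refine Finset.mem_image.2 ⟨fun v ↦ e I v, ?_, ?_⟩
    · refine Fintype.mem_piFinset.2 fun v ↦ Finset.mem_range.2 (Nat.lt_succ_of_le ?_)
      calc e I v ≤ ∑ v ∈ T, e I v := Finset.single_le_sum (fun _ _ ↦ Nat.zero_le _) v.2
        _ ≤ m := Finset.single_le_sum (f := fun I ↦ ∑ v ∈ T, e I v)
            (fun _ _ ↦ Nat.zero_le _) hIF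
    · rw [Finset.prod_coe_sort T (fun v ↦ v.asIdeal ^ e I v)]
      exact ht I hI0 T (Finset.subset_biUnion_of_mem t hIF)
  calc ∑ I ∈ F, (Ideal.absNorm I : ℝ) ^ (-s)
      = ∑ I ∈ F.filter (· ≠ ⊥), (Ideal.absNorm I : ℝ) ^ (-s) := by
        refine (Finset.sum_filter_of_ne fun I _ hne ↦ ?_).symm
        rintro rfl
        exact hne (by simp [Real.zero_rpow (by linarith : -s ≠ 0)])
    _ ≤ ∑ I ∈ (Fintype.piFinset fun _ : T ↦ Finset.range (m + 1)).image
          (fun a ↦ ∏ v : T, v.1.asIdeal ^ a v), (Ideal.absNorm I : ℝ) ^ (-s) :=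
        Finset.sum_le_sum_of_subset_of_nonneg hmem (fun _ _ _ ↦ by positivity)
    _ ≤ ∑ a ∈ Fintype.piFinset fun _ : T ↦ Finset.range (m + 1),
          (Ideal.absNorm (∏ v : T, v.1.asIdeal ^ a v) : ℝ) ^ (-s) :=
        Finset.sum_image_le_of_nonneg (fun _ _ ↦ by positivity)
    _ = ∑ a ∈ Fintype.piFinset fun _ : T ↦ Finset.range (m + 1),
          ∏ v : T, ((Ideal.absNorm v.1.asIdeal : ℝ) ^ (-s)) ^ a v := by
        refine Finset.sum_congr rfl fun a _ ↦ ?_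
        rw [absNorm_prod_rpow]
        refine Finset.prod_congr rfl fun v _ ↦ ?_
        rw [map_pow, Nat.cast_pow, ← Real.rpow_natCast, ← Real.rpow_natCast, ← Real.rpow_mul
          (Nat.cast_nonneg _), ← Real.rpow_mul (Nat.cast_nonneg _), mul_comm]
    _ = ∏ v : T, ∑ k ∈ Finset.range (m + 1), ((Ideal.absNorm v.1.asIdeal : ℝ) ^ (-s)) ^ k :=
        (Finset.prod_univ_sum _ _).symm
    _ ≤ ∏ v : T, (1 - (Ideal.absNorm v.1.asIdeal : ℝ) ^ (-s))⁻¹ := by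
        refine Finset.prod_le_prod (fun _ _ ↦ by positivity) fun v _ ↦ ?_
        have hlt : (Ideal.absNorm v.1.asIdeal : ℝ) ^ (-s) < 1 :=
          (absNorm_rpow_le_half v.1 hs.le).trans_lt (by norm_num)
        rw [← tsum_geometric_of_lt_one (by positivity) hlt]
        exact (summable_geometric_of_lt_one (by positivity) hlt).sum_le_tsum _
          (fun _ _ ↦ by positivity)
    _ = _ := Finset.prod_coe_sort T (fun v ↦ (1 - (Ideal.absNorm v.asIdeal : ℝ) ^ (-s))⁻¹)

theorem summable_heightOneSpectrum_absNorm_rpow_sq {s : ℝ} (hs : 1 < s) :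
    Summable (fun v : HeightOneSpectrum (𝓞 K) ↦ ((Ideal.absNorm v.asIdeal : ℝ) ^ (-s)) ^ 2) := by
  refine Summable.of_nonneg_of_le (fun _ ↦ by positivity) (fun v ↦ ?_)
    (summable_heightOneSpectrum_absNorm_rpow K hs)
  have := absNorm_rpow_le_half v hs.le
  have : 0 ≤ (Ideal.absNorm v.asIdeal : ℝ) ^ (-s) := by positivity
  nlinarith

theorem tsum_absNorm_rpow_sq_le {s : ℝ} (hs : 1 < s) :
    ∑' v : HeightOneSpectrum (𝓞 K), ((Ideal.absNorm v.asIdeal : ℝ) ^ (-s)) ^ 2 ≤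
      ∑' v : HeightOneSpectrum (𝓞 K), (Ideal.absNorm v.asIdeal : ℝ) ^ (-2 : ℝ) := by
  refine (summable_heightOneSpectrum_absNorm_rpow_sq K hs).tsum_le_tsum (fun v ↦ ?_)
    (summable_heightOneSpectrum_absNorm_rpow K one_lt_two)
  have h2 : (2 : ℝ) ≤ Ideal.absNorm v.asIdeal := by exact_mod_cast two_le_absNorm v
  rw [← Real.rpow_natCast, ← Real.rpow_mul (Nat.cast_nonneg _)]
  exact Real.rpow_le_rpow_of_exponent_le (by linarith) (by push_cast; linarith)

theorem abs_log_tsum_sub_tsum_le {s : ℝ} (hs : 1 < s) :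
    |Real.log (∑' I : Ideal (𝓞 K), (Ideal.absNorm I : ℝ) ^ (-s)) -
        ∑' v : HeightOneSpectrum (𝓞 K), (Ideal.absNorm v.asIdeal : ℝ) ^ (-s)| ≤
      ∑' v : HeightOneSpectrum (𝓞 K), (Ideal.absNorm v.asIdeal : ℝ) ^ (-2 : ℝ) := by
  have hx := summable_heightOneSpectrum_absNorm_rpow K hs
  have hx2 := summable_heightOneSpectrum_absNorm_rpow_sq K hs
  have hZ : 0 < ∑' I : Ideal (𝓞 K), (Ideal.absNorm I : ℝ) ^ (-s) := by
    have := prod_one_add_absNorm_rpow_le_tsum K ∅ hs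
    rw [Finset.prod_empty] at this
    linarith
  have lower : ∑' v : HeightOneSpectrum (𝓞 K), ((Ideal.absNorm v.asIdeal : ℝ) ^ (-s) -
      ((Ideal.absNorm v.asIdeal : ℝ) ^ (-s)) ^ 2) ≤
      Real.log (∑' I : Ideal (𝓞 K), (Ideal.absNorm I : ℝ) ^ (-s)) := by
    refine (hx.sub hx2).tsum_le_of_sum_le fun T ↦ ?_
    refine le_trans ?_ (Real.log_le_log (Finset.prod_pos fun v _ ↦ by positivity)
      (prod_one_add_absNorm_rpow_le_tsum K T hs))
    rw [Real.log_prod (fun v _ ↦ by positivity)]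
    refine Finset.sum_le_sum fun v _ ↦ ?_
    have h0 : 0 ≤ (Ideal.absNorm v.asIdeal : ℝ) ^ (-s) := by positivity
    refine le_trans ?_ (Real.le_log_one_add_of_nonneg h0)
    generalize (Ideal.absNorm v.asIdeal : ℝ) ^ (-s) = x at h0 ⊢
    rw [le_div_iff₀ (by linarith)]
    nlinarith [pow_nonneg h0 2, pow_nonneg h0 3]
  have upper : Real.log (∑' I : Ideal (𝓞 K), (Ideal.absNorm I : ℝ) ^ (-s)) ≤
      ∑' v : HeightOneSpectrum (𝓞 K), ((Ideal.absNorm v.asIdeal : ℝ) ^ (-s) +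
      ((Ideal.absNorm v.asIdeal : ℝ) ^ (-s)) ^ 2) := by
    rw [Real.log_le_iff_le_exp hZ]
    refine (summable_absNorm_rpow_and_tsum_eq K hs).1.tsum_le_of_sum_le fun F ↦ ?_
    obtain ⟨T, hT⟩ := sum_absNorm_rpow_le_prod K F hs
    refine hT.trans (le_trans ?_ (Real.exp_le_exp.2
      ((hx.add hx2).sum_le_tsum T (fun _ _ ↦ by positivity))))
    rw [Real.exp_sum]
    refine Finset.prod_le_prod (fun v _ ↦ ?_) (fun v _ ↦ ?_)
    · have := absNorm_rpow_le_half v hs.le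
      exact inv_nonneg.2 (by linarith)
    · have h1 := absNorm_rpow_le_half v hs.le
      have h0 : 0 ≤ (Ideal.absNorm v.asIdeal : ℝ) ^ (-s) := by positivity
      generalize (Ideal.absNorm v.asIdeal : ℝ) ^ (-s) = x at h0 h1 ⊢
      rw [inv_le_iff_one_le_mul₀ (by linarith)]
      have := Real.quadratic_le_exp_of_nonneg (x := x + x ^ 2) (by positivity)
      nlinarith [mul_le_mul_of_nonneg_right this (by linarith : 0 ≤ 1 - x), pow_nonneg h0 2,
        pow_nonneg h0 3, pow_nonneg h0 4]
  have hsq := tsum_absNorm_rpow_sq_le K hs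
  rw [hx.tsum_sub hx2] at lower
  rw [hx.tsum_add hx2] at upper
  rw [abs_le]
  constructor <;> linarith

theorem isBigO_tsum_heightOneSpectrum_add_log :
    (fun s : ℝ ↦ (∑' v : HeightOneSpectrum (𝓞 K), (Ideal.absNorm v.asIdeal : ℝ) ^ (-s)) +
      Real.log (s - 1)) =O[𝓝[>] 1] (fun _ ↦ (1 : ℝ)) := by
  have h : (fun s : ℝ ↦ Real.log (∑' I : Ideal (𝓞 K), (Ideal.absNorm I : ℝ) ^ (-s)) -
      ∑' v : HeightOneSpectrum (𝓞 K), (Ideal.absNorm v.asIdeal : ℝ) ^ (-s))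
      =O[𝓝[>] 1] (fun _ ↦ (1 : ℝ)) := by
    refine IsBigO.of_bound (∑' v : HeightOneSpectrum (𝓞 K),
      (Ideal.absNorm v.asIdeal : ℝ) ^ (-2 : ℝ)) ?_
    filter_upwards [self_mem_nhdsWithin] with s hs
    simpa using abs_log_tsum_sub_tsum_le K hs
  refine ((isBigO_log_tsum_absNorm_add_log K).sub h).congr_left fun s ↦ ?_
  ring

/-- The number of roots modulo `p` of a polynomial with integer coefficients. -/
noncomputable def rootCount (f : Polynomial ℤ) (p : ℕ) : ℕ :=
  Nat.card {x : ZMod p // Polynomial.aeval x f = 0}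

theorem natCard_primesOver_le (p : ℕ) [Fact p.Prime] :
    Nat.card (Ideal.primesOver (Ideal.span {(p : ℤ)}) (𝓞 K)) ≤ Module.finrank ℤ (𝓞 K) := by
  have hp : Ideal.span {(p : ℤ)} ≠ ⊥ := by simp [NeZero.ne p]
  have hmax := Int.ideal_span_isMaximal_of_prime p
  have : Fintype (Ideal.primesOver (Ideal.span {(p : ℤ)}) (𝓞 K)) :=
    (Algebra.QuasiFinite.finite_primesOver _).fintype
  rw [← Ideal.sum_ramification_inertia_eq_finrank (p := Ideal.span {(p : ℤ)}),
    Nat.card_eq_fintype_card, Fintype.card_eq_sum_ones]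
  exact Finset.sum_le_sum fun q _ ↦
    Nat.mul_pos (Ideal.ramificationIdx_pos _ _) (Ideal.inertiaDeg_pos _ _)

omit [NumberField K] in
variable {K} in
theorem card_filter_monicFactorsMod (θ : 𝓞 K) (p : ℕ) [Fact p.Prime] :
    ((RingOfIntegers.monicFactorsMod θ p).filter (·.natDegree = 1)).card =
      rootCount (minpoly ℤ θ) p := by
  classical
  have h0 : (minpoly ℤ θ).map (Int.castRingHom (ZMod p)) ≠ 0 :=
    Polynomial.map_monic_ne_zero (minpoly.monic (RingOfIntegers.isIntegral θ))
  have hroot (x : ZMod p) : Polynomial.X - Polynomial.C x ∣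
      (minpoly ℤ θ).map (Int.castRingHom (ZMod p)) ↔ Polynomial.aeval x (minpoly ℤ θ) = 0 := by
    rw [Polynomial.dvd_iff_isRoot, Polynomial.IsRoot, Polynomial.eval_map, Polynomial.aeval_def]
    rfl
  rw [rootCount, Nat.card_eq_fintype_card, Fintype.card_subtype]
  symm
  refine Finset.card_bij (fun x _ ↦ Polynomial.X - Polynomial.C x) (fun x hx ↦ ?_)
    (fun x _ y _ h ↦ by simpa using h) (fun Q hQ ↦ ?_)
  · rw [Finset.mem_filter, Multiset.mem_toFinset, Polynomial.mem_normalizedFactors_iff h0, hroot]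
    exact ⟨⟨Polynomial.irreducible_X_sub_C x, Polynomial.monic_X_sub_C x,
      (Finset.mem_filter.1 hx).2⟩, Polynomial.natDegree_X_sub_C x⟩
  · rw [Finset.mem_filter, Multiset.mem_toFinset, Polynomial.mem_normalizedFactors_iff h0] at hQ
    obtain ⟨⟨-, hmonic, hdvd⟩, hdeg⟩ := hQ
    have hQ : Q = Polynomial.X - Polynomial.C (-Q.coeff 0) := by
      rw [map_neg, sub_neg_eq_add]
      exact hmonic.eq_X_add_C hdeg
    refine ⟨-Q.coeff 0, Finset.mem_filter.2 ⟨Finset.mem_univ _, ?_⟩, hQ.symm⟩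
    rw [← hroot, ← hQ]
    exact hdvd

theorem abs_tsum_primesOver_sub_le {θ : 𝓞 K} {p : ℕ} [Fact p.Prime]
    (hp : ¬ p ∣ RingOfIntegers.exponent θ) {s : ℝ} (hs : 1 ≤ s) :
    |∑' P : Ideal.primesOver (Ideal.span {(p : ℤ)}) (𝓞 K), (Ideal.absNorm P.1 : ℝ) ^ (-s) -
      rootCount (minpoly ℤ θ) p * (p : ℝ) ^ (-s)| ≤
        Module.finrank ℤ (𝓞 K) * (p : ℝ) ^ (-2 : ℝ) := by
  classical
  have hnorm : ∀ Q : RingOfIntegers.monicFactorsMod θ p,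
      (Ideal.absNorm ((NumberField.Ideal.primesOverSpanEquivMonicFactorsMod hp).symm Q).1 : ℝ)
        ^ (-s) = (p : ℝ) ^ (-(Q.1.natDegree * s)) := by
    rintro ⟨Q, hQ⟩
    rw [← Ideal.pow_inertiaDeg p,
      NumberField.Ideal.inertiaDeg_primesOverSpanEquivMonicFactorsMod_symm_apply' hp hQ,
      Nat.cast_pow, ← Real.rpow_natCast, ← Real.rpow_mul (by positivity), mul_neg]
  have hp1 : (1 : ℝ) ≤ p := by exact_mod_cast (Fact.out : p.Prime).one_le
  rw [← (NumberField.Ideal.primesOverSpanEquivMonicFactorsMod hp).symm.tsum_eq, tsum_congr hnorm,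
    tsum_fintype, Finset.sum_coe_sort (RingOfIntegers.monicFactorsMod θ p)
      (fun Q ↦ (p : ℝ) ^ (-(Q.natDegree * s))),
    ← Finset.sum_filter_add_sum_filter_not _ (fun Q : Polynomial (ZMod p) ↦ Q.natDegree = 1),
    Finset.sum_congr rfl (g := fun _ ↦ (p : ℝ) ^ (-s)) (fun Q hQ ↦ by
      rw [(Finset.mem_filter.1 hQ).2, Nat.cast_one, one_mul]),
    Finset.sum_const, card_filter_monicFactorsMod, nsmul_eq_mul, add_sub_cancel_left, abs_of_nonneg
      (by positivity)]
  refine (Finset.sum_le_card_nsmul _ _ ((p : ℝ) ^ (-2 : ℝ)) fun Q hQ ↦ ?_).trans ?_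
  · rw [Finset.mem_filter, Multiset.mem_toFinset] at hQ
    have hQ0 : Q.natDegree ≠ 0 := by
      have := UniqueFactorizationMonoid.irreducible_of_normalized_factor _ hQ.1
      exact this.natDegree_pos.ne'
    have h2 : (2 : ℝ) ≤ Q.natDegree := by exact_mod_cast (by omega : 2 ≤ Q.natDegree)
    exact Real.rpow_le_rpow_of_exponent_le hp1 (by nlinarith)
  · rw [nsmul_eq_mul]
    gcongr
    refine (Finset.card_filter_le _ _).trans ?_
    refine le_trans (le_of_eq ?_) (natCard_primesOver_le K p)
    rw [Nat.card_congr (NumberField.Ideal.primesOverSpanEquivMonicFactorsMod hp),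
      Nat.card_eq_fintype_card, Fintype.card_coe]

theorem rootCount_le {f : Polynomial ℤ} (hf : f.Monic) (p : ℕ) [Fact p.Prime] :
    rootCount f p ≤ f.natDegree := by
  classical
  have h0 : f.map (Int.castRingHom (ZMod p)) ≠ 0 := Polynomial.map_monic_ne_zero hf
  rw [rootCount, Nat.card_eq_fintype_card, Fintype.card_subtype]
  calc _ ≤ (f.map (Int.castRingHom (ZMod p))).roots.toFinset.card := by
        refine Finset.card_le_card fun x hx ↦ ?_
        rw [Multiset.mem_toFinset, Polynomial.mem_roots h0, Polynomial.IsRoot, Polynomial.eval_map]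
        exact (Finset.mem_filter.1 hx).2
    _ ≤ _ := (Multiset.toFinset_card_le _).trans (Polynomial.card_roots' _)
    _ ≤ f.natDegree := Polynomial.natDegree_map_le

variable {K} in
theorem abs_tsum_primesOver_sub_le' (θ : 𝓞 K) (p : ℕ) [Fact p.Prime] {s : ℝ} (hs : 1 ≤ s) :
    |∑' P : Ideal.primesOver (Ideal.span {(p : ℤ)}) (𝓞 K), (Ideal.absNorm P.1 : ℝ) ^ (-s) -
      rootCount (minpoly ℤ θ) p * (p : ℝ) ^ (-s)| ≤
        Module.finrank ℤ (𝓞 K) + (minpoly ℤ θ).natDegree := by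
  have hp : Ideal.span {(p : ℤ)} ≠ ⊥ := by simp [NeZero.ne p]
  have : Fintype (Ideal.primesOver (Ideal.span {(p : ℤ)}) (𝓞 K)) :=
    (Algebra.QuasiFinite.finite_primesOver _).fintype
  have hp1 : (1 : ℝ) ≤ p := by exact_mod_cast (Fact.out : p.Prime).one_le
  have hle : (p : ℝ) ^ (-s) ≤ 1 := Real.rpow_le_one_of_one_le_of_nonpos hp1 (by linarith)
  have h1 : ∑' P : Ideal.primesOver (Ideal.span {(p : ℤ)}) (𝓞 K), (Ideal.absNorm P.1 : ℝ) ^ (-s)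
      ≤ Module.finrank ℤ (𝓞 K) := by
    rw [tsum_fintype]
    refine (Finset.sum_le_card_nsmul _ _ 1 fun P _ ↦ ?_).trans ?_
    · have : P.1 ≠ ⊥ := Ideal.ne_bot_of_mem_primesOver hp P.2
      refine Real.rpow_le_one_of_one_le_of_nonpos ?_ (by linarith)
      exact_mod_cast Nat.one_le_iff_ne_zero.2 (by rwa [Ne, Ideal.absNorm_eq_zero_iff])
    · rw [nsmul_one, Finset.card_univ, ← Nat.card_eq_fintype_card]
      exact_mod_cast natCard_primesOver_le K p
  have h2 : rootCount (minpoly ℤ θ) p * (p : ℝ) ^ (-s) ≤ (minpoly ℤ θ).natDegree := by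
    have : (rootCount (minpoly ℤ θ) p : ℝ) ≤ (minpoly ℤ θ).natDegree := by
      exact_mod_cast rootCount_le (minpoly.monic (RingOfIntegers.isIntegral θ)) p
    exact (mul_le_of_le_one_right (by positivity) hle).trans this
  have h3 : 0 ≤ ∑' P : Ideal.primesOver (Ideal.span {(p : ℤ)}) (𝓞 K),
    (Ideal.absNorm P.1 : ℝ) ^ (-s) := tsum_nonneg fun _ ↦ by positivity
  have h4 : 0 ≤ rootCount (minpoly ℤ θ) p * (p : ℝ) ^ (-s) := by positivity
  rw [abs_le]
  constructor <;> linarith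

theorem exponent_ne_zero {θ : 𝓞 K} (hθ : Algebra.adjoin ℚ {(θ : K)} = ⊤) :
    RingOfIntegers.exponent θ ≠ 0 := by
  have h := conductor_mul_differentIdeal ℤ ℚ K θ hθ
  have hne : Polynomial.aeval θ (minpoly ℤ θ).derivative ≠ 0 := by
    intro h0
    have hs : Polynomial.aeval (θ : K) (minpoly ℚ (θ : K)).derivative ≠ 0 :=
      (Algebra.IsSeparable.isSeparable ℚ (θ : K)).aeval_derivative_ne_zero (minpoly.aeval _ _)
    apply hs
    rw [minpoly.isIntegrallyClosed_eq_field_fractions ℚ K (RingOfIntegers.isIntegral θ),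
      Polynomial.derivative_map, Polynomial.aeval_map_algebraMap, Polynomial.aeval_algebraMap_apply,
      h0, map_zero]
  have hc : conductor ℤ θ ≠ ⊥ := by
    intro hc
    rw [hc, Ideal.bot_mul, eq_comm, Ideal.span_singleton_eq_bot] at h
    exact hne h
  rw [RingOfIntegers.exponent, Ne, Ideal.absNorm_eq_zero_iff]
  exact fun h ↦ hc (Ideal.eq_bot_of_comap_eq_bot h)

/-- Every nonzero prime ideal of the ring of integers lies over exactly one rational prime. -/
theorem bijective_sigma_primesOver :
    Function.Bijective (fun x : (Σ p : Nat.Primes, Ideal.primesOver (Ideal.span {(p : ℤ)}) (𝓞 K)) ↦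
      (⟨x.2.1, x.2.2.1, Ideal.ne_bot_of_mem_primesOver (by simp [x.1.2.ne_zero]) x.2.2⟩ :
        HeightOneSpectrum (𝓞 K))) := by
  constructor
  · rintro ⟨p, P, hP⟩ ⟨q, Q, hQ⟩ h
    have hPQ : P = Q := congrArg HeightOneSpectrum.asIdeal h
    subst hPQ
    have hpq : Ideal.span {(p : ℤ)} = Ideal.span {(q : ℤ)} := hP.2.over.trans hQ.2.over.symm
    have : p = q := by
      rw [Ideal.span_singleton_eq_span_singleton, Int.associated_iff] at hpq
      have := p.2.pos
      exact Subtype.ext (by omega)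
    subst this
    rfl
  · intro v
    have : NeZero v.asIdeal := ⟨v.ne_bot⟩
    have := v.isPrime
    exact ⟨⟨⟨_, Nat.absNorm_under_prime v.asIdeal⟩, v.asIdeal, v.isPrime,
      ⟨Int.ideal_span_absNorm_eq_self _⟩⟩, rfl⟩

theorem summable_primes_rootCount {f : Polynomial ℤ} (hf : f.Monic) {s : ℝ} (hs : 1 < s) :
    Summable (fun p : Nat.Primes ↦ rootCount f p * (p : ℝ) ^ (-s)) := by
  have h : Summable (fun p : Nat.Primes ↦ f.natDegree * (p : ℝ) ^ (-s)) :=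
    (Nat.Primes.summable_rpow.2 (by linarith)).mul_left _
  refine h.of_nonneg_of_le (fun p ↦ by positivity) fun p ↦ ?_
  have := Fact.mk p.2
  have : (rootCount f p : ℝ) ≤ f.natDegree := by exact_mod_cast rootCount_le hf p
  gcongr

variable {K} in
theorem isBigO_tsum_rootCount_minpoly_add_log {θ : 𝓞 K} (hθ : Algebra.adjoin ℚ {(θ : K)} = ⊤) :
    (fun s : ℝ ↦ (∑' p : Nat.Primes, rootCount (minpoly ℤ θ) p * (p : ℝ) ^ (-s)) +
      Real.log (s - 1)) =O[𝓝[>] 1] (fun _ ↦ (1 : ℝ)) := by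
  classical
  let d := Module.finrank ℤ (𝓞 K)
  let bad : Set Nat.Primes := {p | (p : ℕ) ∣ RingOfIntegers.exponent θ}
  have hbad : bad.Finite := by
    refine Set.Finite.of_finite_image (f := fun p : Nat.Primes ↦ (p : ℕ)) ?_
      Subtype.val_injective.injOn
    refine ((RingOfIntegers.exponent θ).divisors.finite_toSet).subset ?_
    rintro _ ⟨p, hp, rfl⟩
    exact Finset.mem_coe.2 (Nat.mem_divisors.2 ⟨hp, exponent_ne_zero K hθ⟩)
  let c : Nat.Primes → ℝ := fun p ↦ (d : ℝ) * (p : ℝ) ^ (-2 : ℝ) +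
    bad.indicator (fun _ ↦ (d + (minpoly ℤ θ).natDegree : ℝ)) p
  have hc : Summable c := ((Nat.Primes.summable_rpow.2 (by norm_num)).mul_left _).add
    (summable_of_hasFiniteSupport (hbad.subset (Set.support_indicator_subset)))
  have key : ∀ s : ℝ, 1 < s →
      |∑' v : HeightOneSpectrum (𝓞 K), (Ideal.absNorm v.asIdeal : ℝ) ^ (-s) -
      ∑' p : Nat.Primes, rootCount (minpoly ℤ θ) p * (p : ℝ) ^ (-s)| ≤ ∑' p, c p := by
    intro s hs
    let e := Equiv.ofBijective _ (bijective_sigma_primesOver K)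
    have hsum := summable_heightOneSpectrum_absNorm_rpow K hs
    have hsum' : Summable
        (fun x : (Σ p : Nat.Primes, Ideal.primesOver (Ideal.span {(p : ℤ)}) (𝓞 K)) ↦
        (Ideal.absNorm x.2.1 : ℝ) ^ (-s)) := e.summable_iff.2 hsum
    have hsum2 : Summable (fun p : Nat.Primes ↦
      ∑' P : Ideal.primesOver (Ideal.span {(p : ℤ)}) (𝓞 K), (Ideal.absNorm P.1 : ℝ) ^ (-s)) :=
      hsum'.sigma
    have hroot := summable_primes_rootCount (minpoly.monic (RingOfIntegers.isIntegral θ)) hs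
    have heq : ∑' v : HeightOneSpectrum (𝓞 K), (Ideal.absNorm v.asIdeal : ℝ) ^ (-s) =
        ∑' p : Nat.Primes, ∑' P : Ideal.primesOver (Ideal.span {(p : ℤ)}) (𝓞 K),
          (Ideal.absNorm P.1 : ℝ) ^ (-s) := (e.tsum_eq _).symm.trans hsum'.tsum_sigma
    rw [heq, ← hsum2.tsum_sub hroot]
    have hle : ∀ p : Nat.Primes, ‖∑' P : Ideal.primesOver (Ideal.span {(p : ℤ)}) (𝓞 K),
        (Ideal.absNorm P.1 : ℝ) ^ (-s) - rootCount (minpoly ℤ θ) p * (p : ℝ) ^ (-s)‖ ≤ c p := by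
      intro p
      have := Fact.mk p.2
      by_cases hp : p ∈ bad
      · refine (abs_tsum_primesOver_sub_le' θ p hs.le).trans ?_
        simp only [c, Set.indicator_of_mem hp]
        exact le_add_of_nonneg_left (by positivity)
      · refine (abs_tsum_primesOver_sub_le K hp hs.le).trans ?_
        simp only [c, Set.indicator_of_notMem hp, add_zero]
        exact le_rfl
    exact tsum_of_norm_bounded hc.hasSum hle
  have h : (fun s : ℝ ↦ (∑' v : HeightOneSpectrum (𝓞 K), (Ideal.absNorm v.asIdeal : ℝ) ^ (-s)) -
      ∑' p : Nat.Primes, rootCount (minpoly ℤ θ) p * (p : ℝ) ^ (-s))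
      =O[𝓝[>] 1] (fun _ ↦ (1 : ℝ)) := by
    refine IsBigO.of_bound (∑' p, c p) ?_
    filter_upwards [self_mem_nhdsWithin] with s hs
    simpa using key s hs
  refine ((isBigO_tsum_heightOneSpectrum_add_log K).sub h).congr_left fun s ↦ ?_
  ring

end NumberField

theorem isBigO_tsum_rootCount_add_log {f : Polynomial ℤ} (hf : f.Monic)
    (hirr : Irreducible (f.map (Int.castRingHom ℚ))) :
    (fun s : ℝ ↦ (∑' p : Nat.Primes, rootCount f p * (p : ℝ) ^ (-s)) +
      Real.log (s - 1)) =O[𝓝[>] 1] (fun _ ↦ (1 : ℝ)) := by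
  have := Fact.mk hirr
  have hfin : FiniteDimensional ℚ (AdjoinRoot (f.map (Int.castRingHom ℚ))) :=
    (AdjoinRoot.powerBasis hirr.ne_zero).finite
  have : NumberField (AdjoinRoot (f.map (Int.castRingHom ℚ))) :=
    { to_finiteDimensional := hfin, to_charZero := algebraRat.charZero _ }
  let r := AdjoinRoot.root (f.map (Int.castRingHom ℚ))
  have hr : Polynomial.aeval r f = 0 := by
    have := AdjoinRoot.eval₂_root (f.map (Int.castRingHom ℚ))
    rw [Polynomial.eval₂_map] at this
    rw [Polynomial.aeval_def, ← this]
    congr 1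
  have hint : IsIntegral ℤ r := ⟨f, hf, hr⟩
  let θ : 𝓞 (AdjoinRoot (f.map (Int.castRingHom ℚ))) := ⟨r, hint⟩
  have hmin : minpoly ℤ θ = f := by
    have h1 : minpoly ℤ θ = minpoly ℤ r := by
      have h := minpoly.algebraMap_eq (A := ℤ)
        (RingOfIntegers.coe_injective (K := AdjoinRoot (f.map (Int.castRingHom ℚ)))) θ
      exact h.symm
    have h2 := minpoly.isIntegrallyClosed_eq_field_fractions' ℚ hint
    apply Polynomial.map_injective (Int.castRingHom ℚ) Int.cast_injective
    rw [h1]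
    refine h2.symm.trans ?_
    symm
    apply minpoly.eq_of_irreducible_of_monic hirr _ (hf.map _)
    exact (Polynomial.aeval_map_algebraMap ℚ r f).trans hr
  have hθ : Algebra.adjoin ℚ {(θ : AdjoinRoot (f.map (Int.castRingHom ℚ)))} = ⊤ :=
    AdjoinRoot.adjoinRoot_eq_top
  simpa only [hmin] using isBigO_tsum_rootCount_minpoly_add_log hθ

theorem rootCount_X (p : ℕ) : rootCount Polynomial.X p = 1 := by
  simp [rootCount]

theorem rootCount_X_pow_sub_C (q : ℕ) (a : ℤ) (p : ℕ) :
    rootCount (Polynomial.X ^ q - Polynomial.C a) p = Nat.card {x : ZMod p // x ^ q = a} := by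
  simp [rootCount, sub_eq_zero]

section FiniteField

variable {F : Type*} [Field F] [Finite F] {q : ℕ}

omit [Finite F] in
theorem natCard_pow_eq_of_isPrimitiveRoot {ζ : F} (hζ : IsPrimitiveRoot ζ q) (hq : 0 < q) {a : F}
    (ha : a ≠ 0) (h : ∃ x, x ^ q = a) : Nat.card {x : F // x ^ q = a} = q := by
  classical
  have h1 := hζ.card_nthRoots a
  rw [if_pos h, ← Multiset.toFinset_card_of_nodup (hζ.nthRoots_nodup ha)] at h1
  refine Eq.trans ?_ h1
  rw [← Nat.card_eq_finsetCard]
  exact Nat.card_congr (Equiv.subtypeEquivRight fun x ↦ by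
    rw [Multiset.mem_toFinset, Polynomial.mem_nthRoots hq])

theorem natCard_pow_eq_one_of_injective (h : ∀ x : F, x ^ q = 1 → x = 1) (hq : q ≠ 0) (a : F) :
    Nat.card {x : F // x ^ q = a} = 1 := by
  have hinj : Function.Injective (fun x : F ↦ x ^ q) := by
    intro x y hxy
    change x ^ q = y ^ q at hxy
    by_cases hy : y = 0
    · rw [hy, zero_pow hq] at hxy
      rw [hy]
      exact pow_eq_zero_iff hq |>.1 hxy
    · rw [← div_eq_one_iff_eq hy]
      exact h _ (by rw [div_pow, hxy, div_self (pow_ne_zero _ hy)])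
  obtain ⟨x, hx⟩ := Finite.surjective_of_injective hinj a
  rw [Nat.card_eq_one_iff_unique]
  exact ⟨⟨fun u v ↦ Subtype.ext (hinj (u.2.trans v.2.symm))⟩, ⟨x, hx⟩⟩

theorem exists_mul_pow_eq_pow_of_isPrimitiveRoot {ζ : F} (hζ : IsPrimitiveRoot ζ q) (hq : q.Prime)
    {b c : F} (hb : b ≠ 0) (hc : c ≠ 0) (hcq : ¬ ∃ x, x ^ q = c) :
    ∃ j < q, ∃ x, x ^ q = b * c ^ j := by
  have := Fact.mk hq
  let H := (powMonoidHom q : Fˣ →* Fˣ).range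
  have hdvd : q ∣ Nat.card Fˣ := by
    rw [(hζ.isUnit_unit' hq.ne_zero).eq_orderOf]
    exact orderOf_dvd_natCard _
  have hcard : Nat.card (Fˣ ⧸ H) = q := by
    change H.index = q
    rw [IsCyclic.index_powMonoidHom_range, Nat.gcd_eq_right hdvd]
  have hc1 : (QuotientGroup.mk (Units.mk0 c hc) : Fˣ ⧸ H) ≠ 1 := by
    rw [Ne, QuotientGroup.eq_one_iff]
    rintro ⟨x, hx⟩
    exact hcq ⟨x, by simpa using congrArg Units.val hx⟩
  obtain ⟨j, hj⟩ := mem_powers_of_prime_card hcard hc1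
    (g' := (QuotientGroup.mk (Units.mk0 b hb))⁻¹)
  refine ⟨j % q, Nat.mod_lt _ hq.pos, ?_⟩
  have hmem : Units.mk0 b hb * Units.mk0 c hc ^ (j % q) ∈ H := by
    rw [← QuotientGroup.eq_one_iff, QuotientGroup.mk_mul, QuotientGroup.mk_pow]
    have := pow_mod_natCard (QuotientGroup.mk (Units.mk0 c hc) : Fˣ ⧸ H) j
    rw [hcard] at this
    rw [this]
    change _ ^ j = _ at hj
    rw [hj, mul_inv_cancel]
  obtain ⟨x, hx⟩ := hmem
  exact ⟨x, by simpa using congrArg Units.val hx⟩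

end FiniteField

theorem one_add_rootCount_le_sum {q : ℕ} (hq : q.Prime) {b c : ℤ} {p : ℕ} [Fact p.Prime]
    (hpq : (q : ZMod p) ≠ 0) (hb : (b : ZMod p) ≠ 0) (hc : (c : ZMod p) ≠ 0)
    (h : (∃ x : ZMod p, x ^ q = c) → ∃ x : ZMod p, x ^ q = b) :
    1 + (q - 1) * rootCount (Polynomial.X ^ q - Polynomial.C c) p +
      rootCount (Polynomial.cyclotomic q ℤ) p ≤
    ∑ j ∈ Finset.range q, rootCount (Polynomial.X ^ q - Polynomial.C (b * c ^ j)) p := by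
  have := Fact.mk hq
  have : NeZero (q : ZMod p) := ⟨hpq⟩
  have h1q : 1 ≤ q := hq.one_le
  have hiff (ζ : ZMod p) : Polynomial.aeval ζ (Polynomial.cyclotomic q ℤ) = 0 ↔
      IsPrimitiveRoot ζ q := by
    rw [← Polynomial.isRoot_cyclotomic_iff, Polynomial.IsRoot,
      ← Polynomial.map_cyclotomic_int q (ZMod p), Polynomial.eval_map]
    rfl
  simp only [rootCount_X_pow_sub_C, Int.cast_mul, Int.cast_pow]
  by_cases hζ : ∃ ζ : ZMod p, IsPrimitiveRoot ζ q
  · obtain ⟨ζ, hζ⟩ := hζ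
    have hcyc : rootCount (Polynomial.cyclotomic q ℤ) p ≤ q - 1 := by
      refine (rootCount_le (Polynomial.cyclotomic.monic q ℤ) p).trans ?_
      rw [Polynomial.natDegree_cyclotomic, Nat.totient_prime hq]
    by_cases hcq : ∃ x : ZMod p, x ^ q = c
    · rw [natCard_pow_eq_of_isPrimitiveRoot hζ hq.pos hc hcq]
      obtain ⟨y, hy⟩ := hcq
      obtain ⟨z, hz⟩ := h ⟨y, hy⟩
      rw [Finset.sum_congr rfl (g := fun _ ↦ q) fun j _ ↦
        natCard_pow_eq_of_isPrimitiveRoot hζ hq.pos (mul_ne_zero hb (pow_ne_zero j hc))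
          ⟨z * y ^ j, by rw [mul_pow, hz, ← hy]; ring⟩, Finset.sum_const, Finset.card_range,
        smul_eq_mul]
      obtain ⟨n, rfl⟩ : ∃ n, q = n + 1 := ⟨q - 1, by omega⟩
      simp only [Nat.add_sub_cancel] at hcyc ⊢
      nlinarith
    · have h0 : Nat.card {x : ZMod p // x ^ q = c} = 0 := by
        rw [Nat.card_eq_zero]
        exact Or.inl ⟨fun x ↦ hcq ⟨x, x.2⟩⟩
      obtain ⟨j, hj, hx⟩ := exists_mul_pow_eq_pow_of_isPrimitiveRoot hζ hq hb hc hcq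
      calc _ ≤ q := by rw [h0]; omega
        _ = Nat.card {x : ZMod p // x ^ q = b * c ^ j} :=
          (natCard_pow_eq_of_isPrimitiveRoot hζ hq.pos (mul_ne_zero hb (pow_ne_zero j hc)) hx).symm
        _ ≤ _ := Finset.single_le_sum
          (f := fun j ↦ Nat.card {x : ZMod p // x ^ q = (b : ZMod p) * (c : ZMod p) ^ j})
          (fun _ _ ↦ Nat.zero_le _) (Finset.mem_range.2 hj)
  · have h0 : rootCount (Polynomial.cyclotomic q ℤ) p = 0 := by
      rw [rootCount, Nat.card_eq_zero]
      exact Or.inl ⟨fun x ↦ hζ ⟨x, (hiff x).1 x.2⟩⟩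
    have hone : ∀ x : ZMod p, x ^ q = 1 → x = 1 := by
      intro x hx
      by_contra hx1
      exact hζ ⟨x, by rw [IsPrimitiveRoot.iff_orderOf]; exact orderOf_eq_prime hx hx1⟩
    simp only [natCard_pow_eq_one_of_injective hone hq.ne_zero, h0, Finset.sum_const,
      Finset.card_range, smul_eq_mul]
    omega

theorem irreducible_map_X_pow_sub_C {q : ℕ} (hq : q.Prime) {a : ℤ} (ha : ∀ x : ℚ, x ^ q ≠ a) :
    Irreducible ((Polynomial.X ^ q - Polynomial.C a).map (Int.castRingHom ℚ)) := by
  simpa using X_pow_sub_C_irreducible_of_prime hq ha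

/-- If `c` and all the `b * c ^ j` are not `q`-th powers, then there are infinitely many primes
modulo which `c` is a `q`-th power and `b` is not. -/
theorem infinite_primes_pow_eq_and_not_pow_eq {q : ℕ} (hq : q.Prime) {b c : ℤ}
    (hc : ∀ x : ℚ, x ^ q ≠ c) (hbc : ∀ j : ℕ, ∀ x : ℚ, x ^ q ≠ b * c ^ j) :
    {p : ℕ | p.Prime ∧ (∃ x : ZMod p, x ^ q = c) ∧ ¬ ∃ x : ZMod p, x ^ q = b}.Infinite := by
  intro hfin
  have hb0 : b ≠ 0 := by
    rintro rfl
    exact hbc 0 0 (by simp [hq.ne_zero])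
  have hc0 : c ≠ 0 := by
    rintro rfl
    exact hc 0 (by simp [hq.ne_zero])
  let f : ℕ → Polynomial ℤ := fun j ↦ Polynomial.X ^ q - Polynomial.C (b * c ^ j)
  let g : Polynomial ℤ := Polynomial.X ^ q - Polynomial.C c
  let S : (Polynomial ℤ) → ℝ → ℝ := fun f s ↦ ∑' p : Nat.Primes, rootCount f p * (p : ℝ) ^ (-s)
  have hf (j : ℕ) : (f j).Monic := Polynomial.monic_X_pow_sub_C _ hq.ne_zero
  have hg : g.Monic := Polynomial.monic_X_pow_sub_C _ hq.ne_zero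
  have hΦ := Polynomial.cyclotomic.monic q ℤ
  have hO1 := isBigO_tsum_rootCount_add_log Polynomial.monic_X
    (by rw [Polynomial.map_X]; exact Polynomial.irreducible_X)
  have hO2 := isBigO_tsum_rootCount_add_log hg (irreducible_map_X_pow_sub_C hq hc)
  have hO3 := isBigO_tsum_rootCount_add_log hΦ (by
    rw [Polynomial.map_cyclotomic]; exact Polynomial.cyclotomic.irreducible_rat hq.pos)
  have hO4 : (fun s : ℝ ↦ ∑ j ∈ Finset.range q, (S (f j) s + Real.log (s - 1)))
      =O[𝓝[>] 1] (fun _ ↦ (1 : ℝ)) :=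
    IsBigO.fun_sum fun j _ ↦ isBigO_tsum_rootCount_add_log (hf j)
      (irreducible_map_X_pow_sub_C hq (by push_cast; exact hbc j))
  let bad : Set Nat.Primes := {p | ¬ (1 + (q - 1) * rootCount g p +
      rootCount (Polynomial.cyclotomic q ℤ) p ≤ ∑ j ∈ Finset.range q, rootCount (f j) p)}
  have hbad : bad.Finite := by
    refine Set.Finite.of_finite_image (f := fun p : Nat.Primes ↦ (p : ℕ)) ?_
      Subtype.val_injective.injOn
    refine (hfin.union ((q * b * c).natAbs.primeFactors.finite_toSet)).subset ?_
    rintro _ ⟨p, hp, rfl⟩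
    by_contra hnot
    rw [Set.mem_union, not_or] at hnot
    have := Fact.mk p.2
    have hndvd : ((q * b * c : ℤ) : ZMod p) ≠ 0 := by
      rw [Ne, ZMod.intCast_zmod_eq_zero_iff_dvd, Int.natCast_dvd]
      intro hd
      refine hnot.2 (Finset.mem_coe.2 (Nat.mem_primeFactors.2 ⟨p.2, hd, ?_⟩))
      simp [hb0, hc0, hq.ne_zero]
    push_cast at hndvd
    refine hp (one_add_rootCount_le_sum hq (left_ne_zero_of_mul (left_ne_zero_of_mul hndvd))
      (right_ne_zero_of_mul (left_ne_zero_of_mul hndvd)) (right_ne_zero_of_mul hndvd) ?_)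
    intro hx
    by_contra hy
    exact hnot.1 ⟨p.2, hx, hy⟩
  let M : ℝ := 1 + (q - 1) * q + (Polynomial.cyclotomic q ℤ).natDegree
  have hM : Summable (bad.indicator fun _ ↦ M) :=
    summable_of_hasFiniteSupport (hbad.subset Set.support_indicator_subset)
  have hq1 : (1 : ℝ) ≤ q := by exact_mod_cast hq.one_le
  have key : ∀ s : ℝ, 1 < s → S Polynomial.X s + (q - 1) * S g s + S (Polynomial.cyclotomic q ℤ) s ≤
      ∑ j ∈ Finset.range q, S (f j) s + ∑' p, bad.indicator (fun _ ↦ M) p := by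
    intro s hs
    have s1 := summable_primes_rootCount Polynomial.monic_X hs
    have s2 := (summable_primes_rootCount hg hs).mul_left (q - 1 : ℝ)
    have s3 := summable_primes_rootCount hΦ hs
    have s4 := fun j ↦ summable_primes_rootCount (hf j) hs
    have s5 := summable_sum fun j (_ : j ∈ Finset.range q) ↦ s4 j
    simp only [S]
    rw [← Summable.tsum_finsetSum fun j _ ↦ s4 j, ← s5.tsum_add hM, ← tsum_mul_left,
      ← s1.tsum_add s2, ← (s1.add s2).tsum_add s3]
    refine ((s1.add s2).add s3).tsum_le_tsum (fun p ↦ ?_) (s5.add hM)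
    have := Fact.mk p.2
    rw [← Finset.sum_mul, rootCount_X, ← mul_assoc, ← add_mul, ← add_mul, Nat.cast_one]
    by_cases hp : p ∈ bad
    · rw [Set.indicator_of_mem hp]
      have hle : (p : ℝ) ^ (-s) ≤ 1 := Real.rpow_le_one_of_one_le_of_nonpos
        (by exact_mod_cast p.2.one_le) (by linarith)
      have h1 : (rootCount g p : ℝ) ≤ q := by
        have := rootCount_le hg p
        rw [Polynomial.natDegree_X_pow_sub_C] at this
        exact_mod_cast this
      have h2 : (rootCount (Polynomial.cyclotomic q ℤ) p : ℝ) ≤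
          (Polynomial.cyclotomic q ℤ).natDegree := by exact_mod_cast rootCount_le hΦ p
      have h3 : (1 + (q - 1) * (rootCount g p : ℝ) +
          rootCount (Polynomial.cyclotomic q ℤ) p) ≤ M := by
        have := mul_le_mul_of_nonneg_left h1 (sub_nonneg.2 hq1)
        simp only [M]
        linarith
      refine le_add_of_nonneg_of_le (by positivity) ?_
      have h4 : 0 ≤ (1 + (q - 1) * (rootCount g p : ℝ) +
        rootCount (Polynomial.cyclotomic q ℤ) p) := by
          have : (0 : ℝ) ≤ q - 1 := by linarith
          positivity
      exact (mul_le_of_le_one_right h4 hle).trans h3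
    · rw [Set.indicator_of_notMem hp, add_zero]
      gcongr
      have := not_not.1 hp
      rw [← Nat.cast_le (α := ℝ)] at this
      push_cast [hq.one_le] at this
      exact this
  have hO : (fun s : ℝ ↦ (∑ j ∈ Finset.range q, S (f j) s - S Polynomial.X s - (q - 1) * S g s -
      S (Polynomial.cyclotomic q ℤ) s) - Real.log (s - 1)) =O[𝓝[>] 1] (fun _ ↦ (1 : ℝ)) := by
    refine (((hO4.sub hO1).sub (hO2.const_mul_left (q - 1 : ℝ))).sub hO3).congr_left fun s ↦ ?_
    simp only [S, Finset.sum_add_distrib, Finset.sum_const, Finset.card_range, nsmul_eq_mul]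
    ring
  obtain ⟨A, hA⟩ := hO.bound
  have hlog : Tendsto (fun s : ℝ ↦ Real.log (s - 1)) (𝓝[>] 1) atBot := by
    refine Real.tendsto_log_nhdsGT_zero.comp ?_
    refine tendsto_nhdsWithin_iff.2 ⟨?_, ?_⟩
    · refine Tendsto.mono_left ?_ nhdsWithin_le_nhds
      have : Continuous fun s : ℝ ↦ s - 1 := by fun_prop
      simpa using this.tendsto 1
    · filter_upwards [self_mem_nhdsWithin] with s hs
      exact sub_pos.2 (Set.mem_Ioi.1 hs)
  obtain ⟨s, hs1, hs2, hs3⟩ := (hA.and ((hlog.eventually_lt_atBot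
    (-A - ∑' p, bad.indicator (fun _ ↦ M) p)).and self_mem_nhdsWithin)).exists
  have h1 := key s hs3
  have h2 := (le_abs_self _).trans hs1
  rw [norm_one, mul_one] at h2
  linarith

theorem not_dvd_den_of_padicValRat_nonneg {p : ℕ} [Fact p.Prime] {x : ℚ}
    (h : 0 ≤ padicValRat p x) : ¬ p ∣ x.den := by
  intro hd
  have hn : ¬ p ∣ x.num.natAbs := fun hn ↦
    (Fact.out : p.Prime).one_lt.ne' (Nat.dvd_one.1 (x.reduced ▸ Nat.dvd_gcd hn hd))
  have h1 := one_le_padicValNat_of_dvd x.den_ne_zero hd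
  have h2 : padicValInt p x.num = 0 := padicValNat.eq_zero_of_not_dvd hn
  rw [padicValRat_def, h2] at h
  omega

theorem dvd_num_of_padicValRat_pos {p : ℕ} [Fact p.Prime] {x : ℚ}
    (h : 0 < padicValRat p x) : (p : ℤ) ∣ x.num := by
  by_contra hn
  have h2 : padicValInt p x.num = 0 := padicValInt.eq_zero_of_not_dvd hn
  rw [padicValRat_def, h2] at h
  omega

theorem padicValRat_eq_zero_iff {p : ℕ} [Fact p.Prime] {x : ℚ} (hx : x ≠ 0) :
    padicValRat p x = 0 ↔ ¬ p ∣ x.num.natAbs ∧ ¬ p ∣ x.den := by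
  constructor
  · refine fun h ↦ ⟨fun hn ↦ ?_, not_dvd_den_of_padicValRat_nonneg h.ge⟩
    have h1 := one_le_padicValNat_of_dvd (by simpa using hx) hn
    have h2 := padicValNat.eq_zero_of_not_dvd (not_dvd_den_of_padicValRat_nonneg h.ge)
    rw [padicValRat_def, h2, padicValInt] at h
    omega
  · rintro ⟨h1, h2⟩
    rw [padicValRat_def, padicValInt, padicValNat.eq_zero_of_not_dvd h1,
      padicValNat.eq_zero_of_not_dvd h2]
    rfl

theorem finite_setOf_padicValRat_ne_zero {x : ℚ} (hx : x ≠ 0) :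
    {p : ℕ | p.Prime ∧ padicValRat p x ≠ 0}.Finite := by
  refine ((x.num.natAbs * x.den).primeFactors.finite_toSet).subset ?_
  rintro p ⟨hp, h⟩
  have := Fact.mk hp
  rw [Ne, padicValRat_eq_zero_iff hx, ← not_or, not_not, ← hp.dvd_mul] at h
  exact Finset.mem_coe.2 (Nat.mem_primeFactors.2 ⟨hp, h, by simp [hx]⟩)

theorem exists_padicValRat_ne_zero {x : ℚ} (hx : x ≠ 0) (h1 : x ≠ 1) (h2 : x ≠ -1) :
    ∃ p : ℕ, p.Prime ∧ padicValRat p x ≠ 0 := by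
  by_contra! h
  have hval : ∀ p : ℕ, p.Prime → ¬ p ∣ x.num.natAbs ∧ ¬ p ∣ x.den := by
    intro p hp
    have := Fact.mk hp
    exact (padicValRat_eq_zero_iff hx).1 (h p hp)
  have hnum : x.num.natAbs = 1 := Nat.eq_one_iff_not_exists_prime_dvd.2 fun p hp ↦ (hval p hp).1
  have hden : x.den = 1 := Nat.eq_one_iff_not_exists_prime_dvd.2 fun p hp ↦ (hval p hp).2
  have hx' : (x.num : ℚ) = x := Rat.den_eq_one_iff _ |>.1 hden
  rcases Int.natAbs_eq x.num with h | h
  · exact h1 (by rw [← hx', h, hnum]; simp)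
  · exact h2 (by rw [← hx', h, hnum]; simp)

theorem cast_zpow_of_num_ne_zero {F : Type*} [Field F] (x : ℚ) (k : ℤ) (hn : (x.num : F) ≠ 0) :
    ((x ^ k : ℚ) : F) = (x : F) ^ k := by
  obtain ⟨n, rfl | rfl⟩ := k.eq_nat_or_neg
  · rw [zpow_natCast, zpow_natCast, Rat.cast_pow]
  · rw [zpow_neg, zpow_neg, zpow_natCast, zpow_natCast, Rat.cast_inv_of_ne_zero, Rat.cast_pow]
    rw [Rat.num_pow, Int.cast_pow]
    exact pow_ne_zero _ hn

theorem cast_zmod_eq_of_padicValRat_sub_pos {p : ℕ} [Fact p.Prime] {x y : ℚ}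
    (hx : padicValRat p x = 0) (hy : padicValRat p y = 0) (h : x = y ∨ 0 < padicValRat p (x - y)) :
    (x : ZMod p) = y := by
  rcases h with rfl | h
  · rfl
  have hden {z : ℚ} (hz : padicValRat p z = 0) : (z.den : ZMod p) ≠ 0 := by
    rw [Ne, ZMod.natCast_eq_zero_iff]
    exact not_dvd_den_of_padicValRat_nonneg hz.ge
  rw [← sub_eq_zero, ← Rat.cast_sub_of_ne_zero (hden hx) (hden hy), Rat.cast_def,
    (ZMod.intCast_zmod_eq_zero_iff_dvd _ _).2 (dvd_num_of_padicValRat_pos h), zero_div]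

theorem cast_num_mul_den_pow (q : ℕ) (hq : q ≠ 0) (x : ℚ) {F : Type*} [Field F]
    (hx : (x.den : F) ≠ 0) :
    ((x.num * x.den ^ (q - 1) : ℤ) : F) = x * x.den ^ q := by
  obtain ⟨n, rfl⟩ : ∃ n, q = n + 1 := ⟨q - 1, by omega⟩
  rw [Rat.cast_def, Nat.add_sub_cancel]
  push_cast
  field_simp
  ring

theorem infinite_setOf_prime_of_forall_pow_ne {B C : ℚ} (hC : C ≠ 0) (hB : B ≠ 0) {q : ℕ}
    (hq : q.Prime) (hCq : ∀ x : ℚ, x ^ q ≠ C) (hBC : ∀ j : ℕ, ∀ x : ℚ, x ^ q ≠ B * C ^ j) :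
    {r : ℕ | r.Prime ∧ padicValRat r B = 0 ∧ padicValRat r C = 0 ∧
      ∀ k : ℤ, ¬(C ^ k = B ∨ 0 < padicValRat r (C ^ k - B))}.Infinite := by
  intro hfin
  let b : ℤ := B.num * B.den ^ (q - 1)
  let c : ℤ := C.num * C.den ^ (q - 1)
  have hBd : (B.den : ℚ) ≠ 0 := by simp
  have hCd : (C.den : ℚ) ≠ 0 := by simp
  have hb : (b : ℚ) = B * B.den ^ q := cast_num_mul_den_pow q hq.ne_zero B hBd
  have hc : (c : ℚ) = C * C.den ^ q := cast_num_mul_den_pow q hq.ne_zero C hCd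
  have hinf := infinite_primes_pow_eq_and_not_pow_eq hq (b := b) (c := c)
    (fun x hx ↦ hCq (x / C.den) (by rw [div_pow, hx, hc]; field_simp))
    (fun j x hx ↦ hBC j (x / (B.den * C.den ^ j)) (by
      rw [div_pow, hx, hb, hc, mul_pow, mul_pow, ← pow_mul, ← pow_mul, mul_comm j q]
      field_simp))
  obtain ⟨p, ⟨hp, ⟨x, hx⟩, hy⟩, hnot⟩ := (hinf.sdiff ((hfin.union
    (finite_setOf_padicValRat_ne_zero hB)).union (finite_setOf_padicValRat_ne_zero hC))).nonempty
  have := Fact.mk hp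
  simp only [Set.mem_union, Set.mem_ofPred_eq, not_or, not_and, not_not] at hnot
  obtain ⟨⟨h1, h2⟩, h3⟩ := hnot
  have hvB := h2 hp
  have hvC := h3 hp
  have h4 := h1 hp hvB hvC
  push Not at h4
  obtain ⟨k, hk⟩ := h4
  have hBp : (B.den : ZMod p) ≠ 0 := by
    rw [Ne, ZMod.natCast_eq_zero_iff]
    exact not_dvd_den_of_padicValRat_nonneg hvB.ge
  have hCp : (C.den : ZMod p) ≠ 0 := by
    rw [Ne, ZMod.natCast_eq_zero_iff]
    exact not_dvd_den_of_padicValRat_nonneg hvC.ge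
  have hCn : (C.num : ZMod p) ≠ 0 := by
    rw [Ne, ZMod.intCast_zmod_eq_zero_iff_dvd, Int.natCast_dvd]
    exact ((padicValRat_eq_zero_iff hC).1 hvC).1
  have hcast : (C : ZMod p) ^ k = B := by
    rw [← cast_zpow_of_num_ne_zero C k hCn]
    exact cast_zmod_eq_of_padicValRat_sub_pos (by rw [padicValRat.zpow, hvC, mul_zero]) hvB
      (or_iff_not_imp_left.2 hk)
  refine hy ⟨(x / C.den) ^ k * B.den, ?_⟩
  have hC' : (x / C.den) ^ q = (C : ZMod p) := by
    rw [div_pow, hx, cast_num_mul_den_pow q hq.ne_zero C hCp]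
    field_simp
  rw [cast_num_mul_den_pow q hq.ne_zero B hBp, mul_pow, ← zpow_natCast, ← zpow_mul, mul_comm k,
    zpow_mul, zpow_natCast, hC', hcast]

theorem dvd_padicValRat_of_pow_eq {p : ℕ} [Fact p.Prime] {q : ℕ} {x y : ℚ} (h : x ^ q = y) :
    (q : ℤ) ∣ padicValRat p y := by
  rw [← h, padicValRat.pow]
  exact dvd_mul_right _ _

theorem stmt10 (B C : ℚ) (hC : C ≠ 0) (hB0 : B ≠ 0) (hB1 : B ≠ 1)
    (hCB : ¬(C = 1 ∧ B = -1))
    (hindep : ∀ k : ℤ, k ≠ 0 → ∀ l : ℤ, B ^ k * C ^ l ≠ 1 ∧ B ^ k * C ^ l ≠ -1) :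
    {r : ℕ | r.Prime ∧ padicValRat r B = 0 ∧ padicValRat r C = 0 ∧
      ∀ k : ℤ, ¬(C ^ k = B ∨ 0 < padicValRat r (C ^ k - B))}.Infinite := by
  by_cases hC1 : C = 1 ∨ C = -1
  · have hBm : B ≠ -1 := by simpa using (hindep 1 one_ne_zero 0).2
    have hs1 : (1 : ℚ) - B ≠ 0 := sub_ne_zero.2 hB1.symm
    have hs2 : (-1 : ℚ) - B ≠ 0 := sub_ne_zero.2 hBm.symm
    refine (Nat.infinite_setOfPred_prime.sdiff (((finite_setOf_padicValRat_ne_zero hB0).union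
      (finite_setOf_padicValRat_ne_zero hs1)).union (finite_setOf_padicValRat_ne_zero hs2))).mono ?_
    rintro p ⟨hp, hnot⟩
    simp only [Set.mem_union, Set.mem_ofPred_eq, not_or, not_and, not_not] at hnot
    obtain ⟨⟨h1, h2⟩, h3⟩ := hnot
    refine ⟨hp, h1 hp, by rcases hC1 with rfl | rfl <;> simp, fun k ↦ ?_⟩
    have hk : C ^ k = 1 ∨ C ^ k = -1 := by
      rcases hC1 with rfl | rfl
      · simp
      · rw [neg_one_zpow_eq_ite]; split_ifs <;> simp
    rcases hk with hk | hk
    · rw [hk, h2 hp]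
      simpa using hB1.symm
    · rw [hk, h3 hp]
      simpa using hBm.symm
  · rw [not_or] at hC1
    obtain ⟨p, hp, hpC⟩ := exists_padicValRat_ne_zero hC hC1.1 hC1.2
    have := Fact.mk hp
    have hD := hindep _ hpC (-padicValRat p B)
    obtain ⟨l, hl, hlD⟩ := exists_padicValRat_ne_zero
      (mul_ne_zero (zpow_ne_zero _ hB0) (zpow_ne_zero _ hC)) hD.1 hD.2
    have := Fact.mk hl
    rw [padicValRat.mul (zpow_ne_zero _ hB0) (zpow_ne_zero _ hC), padicValRat.zpow,
      padicValRat.zpow] at hlD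
    set D := padicValRat p C * padicValRat l B + -padicValRat p B * padicValRat l C with hDdef
    obtain ⟨q, hqD, hq⟩ := Nat.exists_infinite_primes (D.natAbs + 1)
    have hndvd : ¬ (q : ℤ) ∣ D := fun hd ↦ hlD
      (Int.eq_zero_of_dvd_of_natAbs_lt_natAbs hd (by simpa))
    refine infinite_setOf_prime_of_forall_pow_ne hC hB0 hq (fun x hx ↦ hndvd ?_)
      (fun j x hx ↦ hndvd ?_)
    · exact dvd_add ((dvd_padicValRat_of_pow_eq hx).mul_right _)
        ((dvd_padicValRat_of_pow_eq hx).mul_left _)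
    · have h1 := dvd_padicValRat_of_pow_eq (p := p) hx
      have h2 := dvd_padicValRat_of_pow_eq (p := l) hx
      rw [padicValRat.mul hB0 (pow_ne_zero _ hC), padicValRat.pow] at h1 h2
      have heq : D = padicValRat p C * (padicValRat l B + j * padicValRat l C) -
          padicValRat l C * (padicValRat p B + j * padicValRat p C) := by rw [hDdef]; ring
      rw [heq]
      exact dvd_sub (h2.mul_left _) (h1.mul_left _)
end

section
/- Let c₁, c₂ be nonzero rationals with c₁ ∉ {c₂, -c₂}, and b₁, b₂, b₃ nonzero rationals; set u_n = b₁c₁^n + (b₂ + (-1)^n b₃)c₂^n, C = c₁/c₂, B₊ = -(b₂+b₃)/b₁, B₋ = -(b₂-b₃)/b₁. Suppose the terms u_n all lie in ℤ[1/b] for a positive integer b, and that for each B ∈ {B₊, B₋} either (C, B) = (1, -1) or B^k·C^ℓ ∉ {±1} for all k ∈ ℤ\{0}, ℓ ∈ ℤ. Then: no term u_n is zero if and only if there exists an integer m ≥ 2 with gcd(b, m) = 1 such that u_n ∉ m·ℤ[1/b] for all n ∈ ℤ. -/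
/-- `x ∈ ℤ[1/b]`. -/
def inZb (b : ℕ) (x : ℚ) : Prop := ∃ (z : ℤ) (j : ℕ), x = z / b ^ j

/-- `x ∈ m·ℤ[1/b]`. -/
def inMulZb (m b : ℕ) (x : ℚ) : Prop := ∃ (z : ℤ) (j : ℕ), x = m * z / b ^ j

open Filter Topology in
/-- An integer sequence which is a combination of exponentials with rational ratios of absolute
value at least `1`, up to an error tending to `0`, is eventually equal to that combination. -/
theorem eventually_eq_zero_of_int_eq_sum_pow_add {ι : Type*} (s : Finset ι) (ρ : ι → ℚ)
    (hρ : ∀ i ∈ s, 1 ≤ |ρ i|) (a : ι → ℚ) (f : ℕ → ℤ) (r : ℕ → ℚ)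
    (hr : Tendsto r atTop (𝓝 0))
    (hf : ∀ t, (f t : ℚ) = ∑ i ∈ s, a i * ρ i ^ t + r t) :
    ∀ᶠ t in atTop, r t = 0 := by
  classical
  induction s using Finset.induction_on generalizing a f r with
  | empty =>
    have h1 : ∀ᶠ t in atTop, |r t| < 1 :=
      (tendsto_order.1 (by simpa using hr.abs)).2 1 one_pos
    filter_upwards [h1] with t ht
    have h2 : (f t : ℚ) = r t := by simpa using hf t
    rw [← h2] at ht ⊢
    exact_mod_cast Int.abs_lt_one_iff.1 (by exact_mod_cast ht)
  | insert i₀ s hi ih =>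
    set p : ℤ := (ρ i₀).num
    set q : ℤ := ((ρ i₀).den : ℤ)
    have hq : (q : ℚ) ≠ 0 := by simp [q]
    have hpq : (p : ℚ) = q * ρ i₀ := by
      simp only [p, q, Int.cast_natCast]
      rw [mul_comm, Rat.mul_den_eq_num]
    have key := ih (fun i hi => hρ i (Finset.mem_insert_of_mem hi))
      (fun i => a i * (q * ρ i - p)) (fun t => q * f (t + 1) - p * f t)
      (fun t => q * r (t + 1) - p * r t)
      (by simpa using ((hr.comp (tendsto_add_atTop_nat 1)).const_mul (q : ℚ)).sub
            (hr.const_mul (p : ℚ)))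
      (by
        intro t
        push_cast
        rw [hf, hf, Finset.sum_insert hi, Finset.sum_insert hi]
        have : ∑ i ∈ s, a i * (q * ρ i - p) * ρ i ^ t
            = q * ∑ i ∈ s, a i * ρ i ^ (t + 1) - p * ∑ i ∈ s, a i * ρ i ^ t := by
          rw [Finset.mul_sum, Finset.mul_sum, ← Finset.sum_sub_distrib]
          exact Finset.sum_congr rfl fun i _ => by ring
        rw [this, hpq]
        ring)
    obtain ⟨T, hT⟩ := eventually_atTop.1 key
    have hstep : ∀ t ≥ T, r (t + 1) = ρ i₀ * r t := by
      intro t ht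
      have := hT t ht
      rw [hpq] at this
      have h3 : (q : ℚ) * (r (t + 1) - ρ i₀ * r t) = 0 := by linarith
      rcases mul_eq_zero.1 h3 with h | h
      · exact absurd h hq
      · linarith
    have hmono : ∀ t ≥ T, ∀ k, |r t| ≤ |r (t + k)| := by
      intro t ht k
      induction k with
      | zero => simp
      | succ k ihk =>
        refine ihk.trans ?_
        rw [← add_assoc, hstep (t + k) (by omega), abs_mul]
        exact le_mul_of_one_le_left (abs_nonneg _) (hρ i₀ (Finset.mem_insert_self _ _))
    filter_upwards [eventually_ge_atTop T] with t ht
    have hlim : Tendsto (fun k => |r (t + k)|) atTop (𝓝 0) := by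
      have := (hr.comp (tendsto_add_atTop_nat t)).abs
      simpa [Function.comp_def, add_comm] using this
    have := ge_of_tendsto' hlim (hmono t ht)
    exact abs_eq_zero.1 (le_antisymm this (abs_nonneg _))

theorem exists_mul_pow_lt_one {α q : ℚ} (hα : 0 ≤ α) (hq0 : 0 < q) (hq1 : q < 1) :
    ∃ J : ℕ, α * q ^ J < 1 ∧ ∀ j < J, 1 ≤ α * q ^ j := by
  have hex : ∃ J : ℕ, α * q ^ J < 1 := by
    obtain ⟨J, hJ⟩ := exists_pow_lt_of_lt_one (show (0 : ℚ) < 1 / (α + 1) by positivity) hq1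
    refine ⟨J, ?_⟩
    rw [lt_div_iff₀ (by positivity)] at hJ
    nlinarith [pow_pos hq0 J]
  classical
  exact ⟨Nat.find hex, Nat.find_spec hex, fun j hj => not_lt.1 (Nat.find_min hex hj)⟩

theorem inv_one_sub_eq_geom_sum_add {Q : ℚ} (hQ : Q ≠ 1) (J : ℕ) :
    1 / (1 - Q) = ∑ j ∈ Finset.range J, Q ^ j + Q ^ J / (1 - Q) := by
  have h : 1 - Q ≠ 0 := sub_ne_zero.2 hQ.symm
  rw [← sub_eq_iff_eq_add, ← sub_div, div_eq_iff h, geom_sum_mul_neg]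

open Filter Topology in
/-- If the quotients `D (α ^ n - β ^ n) / (1 - q ^ n)` are integers along an arithmetic
progression, then `α` and `β` agree up to powers of `q`. -/
theorem exists_mul_pow_eq_of_forall_int {α β q D : ℚ} {L : ℕ} (hα : 0 ≤ α) (hβ : 0 ≤ β)
    (hq0 : 0 < q) (hq1 : q < 1) (hD : D ≠ 0) (hL : 0 < L)
    (h : ∀ t : ℕ, ∃ k : ℤ,
      (k : ℚ) = D * (α ^ (1 + t * L) - β ^ (1 + t * L)) / (1 - q ^ (1 + t * L))) :
    ∃ i j : ℕ, α * q ^ i = β * q ^ j := by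
  choose f hf using h
  obtain ⟨J, hJ, hJ'⟩ := exists_mul_pow_lt_one hα hq0 hq1
  obtain ⟨K, hK, hK'⟩ := exists_mul_pow_lt_one hβ hq0 hq1
  refine ⟨J, K, ?_⟩
  have hn : Tendsto (fun t : ℕ => 1 + t * L) atTop atTop :=
    tendsto_atTop_mono (fun t => by simp only [id]; nlinarith) tendsto_id
  have hpow : ∀ θ : ℚ, 0 ≤ θ → θ < 1 →
      Tendsto (fun t : ℕ => θ ^ (1 + t * L)) atTop (𝓝 0) := fun θ h0 h1 =>
    (tendsto_pow_atTop_nhds_zero_of_lt_one h0 h1).comp hn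
  have hne : ∀ t : ℕ, q ^ (1 + t * L) ≠ 1 := fun t =>
    (pow_lt_one₀ hq0.le hq1 (by omega)).ne
  have hr : Tendsto (fun t : ℕ => D * ((α * q ^ J) ^ (1 + t * L) - (β * q ^ K) ^ (1 + t * L))
      / (1 - q ^ (1 + t * L))) atTop (𝓝 0) := by
    have := (((hpow (α * q ^ J) (by positivity) hJ).sub
      (hpow (β * q ^ K) (by positivity) hK)).const_mul D).div
      ((hpow q hq0.le hq1).const_sub 1) (by norm_num)
    simpa [Pi.div_def] using this
  have key := eventually_eq_zero_of_int_eq_sum_pow_add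
    ((Finset.range J).disjSum (Finset.range K))
    (Sum.elim (fun j => (α * q ^ j) ^ L) (fun j => (β * q ^ j) ^ L))
    (by
      intro i hi
      rcases i with j | j
      · have := hJ' j (by simpa using hi)
        simpa using (one_le_pow₀ this).trans (le_abs_self _)
      · have := hK' j (by simpa using hi)
        simpa using (one_le_pow₀ this).trans (le_abs_self _))
    (Sum.elim (fun j => D * (α * q ^ j)) (fun j => -(D * (β * q ^ j)))) f _ hr
    (by
      intro t
      have e : ∀ γ : ℚ, ∀ I : ℕ, γ ^ (1 + t * L) / (1 - q ^ (1 + t * L))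
          = ∑ j ∈ Finset.range I, (γ * q ^ j) * ((γ * q ^ j) ^ L) ^ t
            + (γ * q ^ I) ^ (1 + t * L) / (1 - q ^ (1 + t * L)) := by
        intro γ I
        rw [div_eq_mul_one_div, inv_one_sub_eq_geom_sum_add (hne t) I, mul_add, Finset.mul_sum]
        congr 1
        · refine Finset.sum_congr rfl fun j _ => ?_
          ring
        · rw [mul_pow, ← pow_mul, ← pow_mul, mul_comm I]
          ring
      rw [hf, Finset.sum_disjSum]
      simp only [Sum.elim_inl, Sum.elim_inr, neg_mul, Finset.sum_neg_distrib, mul_assoc D,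
        ← Finset.mul_sum]
      rw [mul_div_assoc, sub_div, e α J, e β K]
      ring)
  obtain ⟨t, ht⟩ := key.exists
  have hne' : 1 - q ^ (1 + t * L) ≠ 0 := sub_ne_zero.2 (hne t).symm
  have hsub : (α * q ^ J) ^ (1 + t * L) - (β * q ^ K) ^ (1 + t * L) = 0 := by
    simpa [hD, hne'] using ht
  exact (pow_left_inj₀ (by positivity) (by positivity) (by omega)).1 (sub_eq_zero.1 hsub)

/-- Along a suitable arithmetic progression of exponents `n`, the part of `x ^ n - y ^ n` supported
on the primes dividing `N` divides `x - y`. -/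
theorem exists_progression_sub_pow_eq {x y N : ℕ} (hxy : x.Coprime y) (hlt : y < x)
    (hN : N ≠ 0) :
    ∃ L : ℕ, 0 < L ∧ ∀ t : ℕ, ∃ m : ℤ,
      (x : ℤ) ^ (1 + t * L) - (y : ℤ) ^ (1 + t * L) = (x - y) * m ∧ IsCoprime m N := by
  set P : ℕ := ∏ p ∈ N.primeFactors.filter (fun p => ¬ p ∣ x * y), p with hP
  have hPne : P ≠ 0 := Finset.prod_ne_zero_iff.2 fun p hp =>
    (Nat.prime_of_mem_primeFactors (Finset.mem_filter.1 hp).1).ne_zero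
  have hPc : P.Coprime (x * y) := Nat.Coprime.prod_left fun p hp =>
    ((Nat.prime_of_mem_primeFactors (Finset.mem_filter.1 hp).1).coprime_iff_not_dvd).2
      (Finset.mem_filter.1 hp).2
  set D : ℕ := x - y with hD
  have hDz : (D : ℤ) = x - y := by rw [hD, Nat.cast_sub hlt.le]
  have hD0 : (D : ℤ) ≠ 0 := by omega
  have hDx : x.Coprime D := by
    rw [hD, Nat.coprime_self_sub_right hlt.le]
    exact hxy
  have hDy : y.Coprime D := by
    rw [hD, Nat.coprime_sub_self_right hlt.le]
    exact hxy.symm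
  have hMx : x.Coprime (P * D) :=
    Nat.Coprime.mul_right (hPc.coprime_mul_right_right).symm hDx
  have hMy : y.Coprime (P * D) :=
    Nat.Coprime.mul_right (hPc.coprime_mul_left_right).symm hDy
  refine ⟨(P * D).totient, Nat.totient_pos.2 (Nat.pos_of_ne_zero ?_), fun t => ?_⟩
  · exact mul_ne_zero hPne (by exact_mod_cast hD0)
  have hmod : ∀ v : ℕ, v.Coprime (P * D) →
      (v : ℤ) ^ (1 + t * (P * D).totient) ≡ v [ZMOD ((P * D : ℕ) : ℤ)] := by
    intro v hv
    have h1 := ((Nat.ModEq.pow_totient hv).pow t).mul_left v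
    rw [← pow_mul, one_pow, mul_one, ← pow_succ', mul_comm _ t, add_comm _ 1] at h1
    simpa only [Nat.cast_pow] using Int.natCast_modEq_iff.2 h1
  obtain ⟨k, hk⟩ := ((hmod x hMx).sub (hmod y hMy)).symm.dvd
  have hm : (x : ℤ) ^ (1 + t * (P * D).totient) - (y : ℤ) ^ (1 + t * (P * D).totient)
      = (x - y) * (1 + P * k) := by
    push_cast at hk
    rw [← hDz] at hk ⊢
    linear_combination hk
  refine ⟨1 + P * k, hm, ?_⟩
  rw [Int.isCoprime_iff_gcd_eq_one]
  by_contra hg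
  obtain ⟨p, hp, hpg⟩ := Nat.exists_prime_and_dvd hg
  have hpm : (p : ℤ) ∣ 1 + P * k := (Int.natCast_dvd_natCast.2 hpg).trans (Int.gcd_dvd_left _ _)
  have hpN : p ∣ N := by
    exact_mod_cast (Int.natCast_dvd_natCast.2 hpg).trans (Int.gcd_dvd_right _ _)
  have hpxy : (p : ℤ) ∣ (x : ℤ) ^ (1 + t * (P * D).totient)
      - (y : ℤ) ^ (1 + t * (P * D).totient) := hm ▸ hpm.mul_left _
  have hpi : Prime (p : ℤ) := Nat.prime_iff_prime_int.1 hp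
  by_cases hd : p ∣ x * y
  · have hboth : p ∣ x ∧ p ∣ y := by
      rcases hp.dvd_mul.1 hd with h | h
      · refine ⟨h, ?_⟩
        have : (p : ℤ) ∣ (x : ℤ) := by exact_mod_cast h
        exact_mod_cast hpi.dvd_of_dvd_pow
          ((dvd_sub_right (dvd_pow this (by omega : 1 + t * (P * D).totient ≠ 0))).1 hpxy)
      · refine ⟨?_, h⟩
        have : (p : ℤ) ∣ (y : ℤ) := by exact_mod_cast h
        exact_mod_cast hpi.dvd_of_dvd_pow
          ((dvd_sub_left (dvd_pow this (by omega : 1 + t * (P * D).totient ≠ 0))).1 hpxy)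
    exact Nat.not_coprime_of_dvd_of_dvd hp.one_lt hboth.1 hboth.2 hxy
  · have hpP : p ∣ P := Finset.dvd_prod_of_mem _
      (Finset.mem_filter.2 ⟨Nat.mem_primeFactors.2 ⟨hp, hpN, hN⟩, hd⟩)
    have h1 : (p : ℤ) ∣ P * k := (Int.natCast_dvd_natCast.2 hpP).mul_right k
    exact hpi.not_dvd_one ((dvd_add_left h1).1 hpm)

/-- If `z / w` is not a power of `x / y`, some modulus `m` prime to `N` satisfies
`x ^ n ≡ y ^ n` but `z ^ n ≢ w ^ n` modulo `m` for some `n`. -/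
theorem exists_dvd_sub_pow_not_dvd_sub_pow {x y z w N : ℕ} (hxy : x.Coprime y) (hne : x ≠ y)
    (hx : 0 < x) (hy : 0 < y) (hN : N ≠ 0)
    (h : ∀ i j : ℕ, z * (y ^ i * x ^ j) ≠ w * (y ^ j * x ^ i)) :
    ∃ (m : ℤ) (n : ℕ), IsCoprime m N ∧ m ∣ (x : ℤ) ^ n - (y : ℤ) ^ n ∧ m ≠ 0 ∧
      ¬ m ∣ (z : ℤ) ^ n - (w : ℤ) ^ n := by
  wlog hlt : y < x generalizing x y
  · obtain ⟨m, n, h1, h2, h3⟩ := this hxy.symm hne.symm hy hx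
      (fun i j => by simpa [mul_comm] using h j i) (lt_of_le_of_ne (not_lt.1 hlt) hne)
    exact ⟨m, n, h1, (dvd_sub_comm).1 h2, h3⟩
  by_contra! hcon
  obtain ⟨L, hL, hprog⟩ := exists_progression_sub_pow_eq hxy hlt hN
  have hx' : (0 : ℚ) < x := by exact_mod_cast hx
  have hy' : (0 : ℚ) < y := by exact_mod_cast hy
  have hlt' : (y : ℚ) < x := by exact_mod_cast hlt
  obtain ⟨i, j, hij⟩ := exists_mul_pow_eq_of_forall_int (α := (z : ℚ) / x) (β := (w : ℚ) / x)
    (q := (y : ℚ) / x) (D := (x : ℚ) - y) (L := L) (by positivity) (by positivity)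
    (by positivity) ((div_lt_one hx').2 hlt') (sub_ne_zero.2 hlt'.ne') hL
    (by
      intro t
      obtain ⟨m, hm, hc⟩ := hprog t
      have hpos : (y : ℤ) ^ (1 + t * L) < (x : ℤ) ^ (1 + t * L) :=
        pow_lt_pow_left₀ (by exact_mod_cast hlt) (by positivity) (by omega)
      have hm0 : m ≠ 0 := by
        rintro rfl
        rw [mul_zero] at hm
        omega
      obtain ⟨k, hk⟩ := hcon m (1 + t * L) hc (hm ▸ Dvd.intro_left _ rfl) hm0
      refine ⟨k, ?_⟩
      have hmq : (x : ℚ) ^ (1 + t * L) - (y : ℚ) ^ (1 + t * L) = (x - y) * m := by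
        exact_mod_cast hm
      have hkq : (z : ℚ) ^ (1 + t * L) - (w : ℚ) ^ (1 + t * L) = m * k := by
        exact_mod_cast hk
      have hX : (x : ℚ) ^ (1 + t * L) ≠ 0 := by positivity
      have hm0' : (m : ℚ) ≠ 0 := by exact_mod_cast hm0
      have hd : (x : ℚ) - y ≠ 0 := sub_ne_zero.2 hlt'.ne'
      rw [div_pow, div_pow, div_pow, ← sub_div, one_sub_div hX, hmq, hkq]
      field_simp)
  apply h i j
  have : (z : ℚ) * (y ^ i * x ^ j) = w * (y ^ j * x ^ i) := by
    rw [div_pow, div_pow] at hij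
    field_simp at hij
    linear_combination hij
  exact_mod_cast this

/-- Reduction of a binary exponential sum in `m·ℤ[1/b]` to a congruence. -/
theorem dvd_of_inMulZb {b m : ℕ} (hb : 0 < b) {c₁ c₂ b₁ a : ℚ} {x y z w R S : ℤ} (t : ℕ)
    (hR : R ≠ 0) (hS : S ≠ 0) (hc₂ : c₂ = R / S) (hb₁ : b₁ ≠ 0) (hy : y ≠ 0) (hw : w ≠ 0)
    (hC : c₁ / c₂ = x / y) (hB : -a / b₁ = z / w)
    (hm : IsCoprime (m : ℤ) (b * b₁.num * R))
    (h : inMulZb m b (b₁ * c₁ ^ t + a * c₂ ^ t)) :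
    (m : ℤ) ∣ x ^ t * w - z * y ^ t := by
  obtain ⟨v, j, hv⟩ := h
  have hbq : (b : ℚ) ≠ 0 := by positivity
  have hyq : (y : ℚ) ≠ 0 := by exact_mod_cast hy
  have hwq : (w : ℚ) ≠ 0 := by exact_mod_cast hw
  have hRq : (R : ℚ) ≠ 0 := by exact_mod_cast hR
  have hSq : (S : ℚ) ≠ 0 := by exact_mod_cast hS
  have hc0 : c₂ ≠ 0 := hc₂ ▸ div_ne_zero hRq hSq
  have e1 : c₁ = c₂ * x / y := by
    field_simp at hC ⊢
    linear_combination hC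
  have e2 : a = -(b₁ * z / w) := by
    field_simp at hB ⊢
    linear_combination -hB
  have e3 : (b₁.num : ℚ) = b₁ * b₁.den := (Rat.mul_den_eq_num b₁).symm
  have e4 : (R : ℚ) = c₂ * S := by rw [hc₂, div_mul_cancel₀ _ hSq]
  have key : (x ^ t * w - z * y ^ t) * (b ^ j * b₁.num * R ^ t)
      = m * (v * y ^ t * w * b₁.den * S ^ t) := by
    have : ((x : ℚ) ^ t * w - z * y ^ t) * (b ^ j * b₁.num * R ^ t)
        = m * (v * y ^ t * w * b₁.den * S ^ t) := by
      rw [e3, e4, mul_pow]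
      rw [e1, e2, div_pow, mul_pow] at hv
      field_simp at hv
      linear_combination (b₁.den : ℚ) * S ^ t * hv
    exact_mod_cast this
  have hcop : IsCoprime (m : ℤ) (b ^ j * b₁.num * R ^ t) :=
    ((hm.of_mul_right_left.of_mul_right_left.pow_right).mul_right
      hm.of_mul_right_left.of_mul_right_right).mul_right hm.of_mul_right_right.pow_right
  exact hcop.dvd_of_dvd_mul_right (Dvd.intro _ key.symm)

theorem dvd_sub_pow_of_dvd {m x y z w : ℤ} {n t : ℕ} (hm : IsCoprime m x)
    (h : m ∣ x ^ n - y ^ n) (ht : m ∣ x ^ t * w - z * y ^ t) : m ∣ z ^ n - w ^ n := by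
  have h1 : m ∣ (x ^ t * w) ^ n - (z * y ^ t) ^ n := ht.trans (sub_dvd_pow_sub_pow _ _ n)
  have h2 : m ∣ (x ^ n) ^ t - (y ^ n) ^ t := h.trans (sub_dvd_pow_sub_pow _ _ t)
  have h3 : m ∣ (z ^ n - w ^ n) * (x ^ n) ^ t := by
    have e : (z ^ n - w ^ n) * (x ^ n) ^ t
        = z ^ n * ((x ^ n) ^ t - (y ^ n) ^ t) - ((x ^ t * w) ^ n - (z * y ^ t) ^ n) := by
      ring
    rw [e]
    exact dvd_sub (h2.mul_left _) h1
  exact hm.pow_right.pow_right.dvd_of_dvd_mul_right h3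

theorem exists_modulus_forall_not_inMulZb {b : ℕ} (hb : 0 < b) {c₁ c₂ b₁ a : ℚ}
    (hc₁ : c₁ ≠ 0) (hc₂ : c₂ ≠ 0) (h₁ : c₁ ≠ c₂) (h₂ : c₁ ≠ -c₂) (hb₁ : b₁ ≠ 0)
    (h : ∀ l : ℤ, (-a / b₁) ^ 2 * (c₁ / c₂) ^ l ≠ 1) :
    ∃ m : ℕ, 2 ≤ m ∧ Nat.gcd b m = 1 ∧
      ∀ k : ℤ, ¬ inMulZb m b (b₁ * c₁ ^ k + a * c₂ ^ k) := by
  have hC0 : c₁ / c₂ ≠ 0 := div_ne_zero hc₁ hc₂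
  have hCe : c₁ / c₂ = ((c₁ / c₂).num : ℚ) / ((c₁ / c₂).den : ℤ) := by
    simpa using (Rat.num_div_den (c₁ / c₂)).symm
  have hBe : -a / b₁ = ((-a / b₁).num : ℚ) / ((-a / b₁).den : ℤ) := by
    simpa using (Rat.num_div_den (-a / b₁)).symm
  have hxy : (c₁ / c₂).num.natAbs.Coprime (c₁ / c₂).den := (c₁ / c₂).reduced
  have hx : (c₁ / c₂).num ≠ 0 := Rat.num_ne_zero.2 hC0
  have hy : (c₁ / c₂).den ≠ 0 := (c₁ / c₂).den_nz
  have hw : (-a / b₁).den ≠ 0 := (-a / b₁).den_nz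
  generalize (c₁ / c₂).num = x at *
  generalize (c₁ / c₂).den = y at *
  generalize (-a / b₁).num = z at *
  generalize (-a / b₁).den = w at *
  have hyq : (y : ℚ) ≠ 0 := by exact_mod_cast hy
  have hxq : (x : ℚ) ≠ 0 := by exact_mod_cast hx
  have hwq : (w : ℚ) ≠ 0 := by exact_mod_cast hw
  have habs : ∀ v : ℤ, ((v.natAbs : ℤ)) ^ 2 = v ^ 2 := fun v => by simp
  obtain ⟨m, n, hmN, hmx, hm0, hmz⟩ := exists_dvd_sub_pow_not_dvd_sub_pow
    (x := x.natAbs ^ 2) (y := y ^ 2) (z := z.natAbs ^ 2) (w := w ^ 2)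
    (N := (b * b₁.num * c₂.num * c₂.den * x * y).natAbs)
    (hxy.pow 2 2)
    (by
      intro he
      have : x.natAbs = y := Nat.pow_left_injective two_ne_zero he
      rcases Int.natAbs_eq_iff.1 this with hh | hh
      · rw [hh] at hCe
        rw [Int.cast_natCast, div_self hyq, div_eq_one_iff_eq hc₂] at hCe
        exact h₁ hCe
      · rw [hh] at hCe
        rw [Int.cast_neg, Int.cast_natCast, neg_div, div_self hyq, div_eq_iff hc₂] at hCe
        exact h₂ (by linarith))
    (by positivity) (by positivity)
    (by
      have : b₁.num ≠ 0 := Rat.num_ne_zero.2 hb₁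
      have : c₂.num ≠ 0 := Rat.num_ne_zero.2 hc₂
      have : c₂.den ≠ 0 := c₂.den_nz
      have : b ≠ 0 := hb.ne'
      simp [*])
    (by
      intro i j he
      have heq : (z : ℚ) ^ 2 * ((y ^ 2) ^ i * (x ^ 2) ^ j)
          = w ^ 2 * ((y ^ 2) ^ j * (x ^ 2) ^ i) := by
        have : ((z.natAbs : ℤ) ^ 2) * (((y : ℤ) ^ 2) ^ i * ((x.natAbs : ℤ) ^ 2) ^ j)
          = w ^ 2 * ((y ^ 2) ^ j * ((x.natAbs : ℤ) ^ 2) ^ i) := by exact_mod_cast he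
        rw [habs, habs] at this
        exact_mod_cast this
      apply h (2 * j - 2 * i)
      rw [hCe, hBe, zpow_sub₀ (by simpa using ⟨hx, hy⟩)]
      rw [zpow_mul, zpow_mul, zpow_natCast, zpow_natCast]
      rw [show ∀ r : ℚ, r ^ (2 : ℤ) = r ^ 2 from fun r => zpow_ofNat r 2]
      simp only [Int.cast_natCast, div_pow]
      field_simp
      linear_combination heq)
  push_cast at hmx hmz
  rw [sq_abs, ← pow_mul, ← pow_mul] at hmx hmz
  rw [Int.natCast_natAbs, IsCoprime.abs_right_iff] at hmN
  have hm : (m.natAbs : ℤ) ∣ m := Int.natAbs_dvd.2 dvd_rfl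
  have hcop : IsCoprime (m.natAbs : ℤ) (b * b₁.num * c₂.num * c₂.den * x * y) :=
    hmN.of_isCoprime_of_dvd_left hm
  have hcy := hcop.of_mul_right_right
  have hcx := hcop.of_mul_right_left.of_mul_right_right
  have hcd := hcop.of_mul_right_left.of_mul_right_left.of_mul_right_right
  have hcn := hcop.of_mul_right_left.of_mul_right_left.of_mul_right_left
  have hnum : c₂.num ≠ 0 := Rat.num_ne_zero.2 hc₂
  have hden : (c₂.den : ℤ) ≠ 0 := by exact_mod_cast c₂.den_nz
  have hc₂e : c₂ = (c₂.num : ℚ) / (c₂.den : ℤ) := by simpa using (Rat.num_div_den c₂).symm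
  have hmx' := hm.trans hmx
  refine ⟨m.natAbs, ?_, ?_, fun k hk => hmz (Int.natAbs_dvd.1 ?_)⟩
  · by_contra hlt
    have h0 := Int.natAbs_ne_zero.2 hm0
    exact hmz ((Int.isUnit_iff_natAbs_eq.2 (by omega)).dvd)
  · exact (Nat.isCoprime_iff_coprime.1
      hcn.of_mul_right_left.of_mul_right_left).symm
  · obtain ⟨t, rfl | rfl⟩ := k.eq_nat_or_neg
    · rw [zpow_natCast, zpow_natCast] at hk
      exact dvd_sub_pow_of_dvd hcx hmx' (dvd_of_inMulZb hb t hnum hden hc₂e hb₁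
        (by exact_mod_cast hy) (by exact_mod_cast hw) hCe hBe hcn hk)
    · rw [zpow_neg, zpow_neg, zpow_natCast, zpow_natCast, ← inv_pow, ← inv_pow] at hk
      refine dvd_sub_pow_of_dvd hcy ((dvd_sub_comm).1 hmx') (dvd_of_inMulZb hb t hden hnum
        (c₂ := c₂⁻¹) (by rw [← inv_div, ← hc₂e]) hb₁ hx (by exact_mod_cast hw) ?_ hBe
        (hcn.of_mul_right_left.mul_right hcd) hk)
      rw [← inv_div (x : ℚ), ← hCe, inv_div, inv_div_inv]

theorem inMulZb_of_dvd {m k b : ℕ} {x : ℚ} (h : inMulZb (m * k) b x) : inMulZb m b x := by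
  obtain ⟨z, j, rfl⟩ := h
  exact ⟨k * z, j, by push_cast; ring⟩

theorem stmt16 (b : ℕ) (hb : 0 < b) (c₁ c₂ b₁ b₂ b₃ : ℚ)
    (hc₁ : c₁ ≠ 0) (hc₂ : c₂ ≠ 0) (h₁ : c₁ ≠ c₂) (h₂ : c₁ ≠ -c₂)
    (hb₁ : b₁ ≠ 0) (hb₂ : b₂ ≠ 0) (hb₃ : b₃ ≠ 0)
    (u : ℤ → ℚ) (hu : ∀ n : ℤ, u n = b₁ * c₁ ^ n + (b₂ + (-1 : ℚ) ^ n * b₃) * c₂ ^ n)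
    (hmem : ∀ n : ℤ, inZb b (u n))
    (C Bp Bm : ℚ) (hC : C = c₁ / c₂)
    (hBp : Bp = -(b₂ + b₃) / b₁) (hBm : Bm = -(b₂ - b₃) / b₁)
    (hcase : ∀ B ∈ ({Bp, Bm} : Set ℚ), (C = 1 ∧ B = -1) ∨
      (∀ k : ℤ, k ≠ 0 → ∀ l : ℤ, B ^ k * C ^ l ≠ 1 ∧ B ^ k * C ^ l ≠ -1)) :
    (∀ n : ℤ, u n ≠ 0) ↔
      (∃ m : ℕ, 2 ≤ m ∧ Nat.gcd b m = 1 ∧ ∀ n : ℤ, ¬ inMulZb m b (u n)) := by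
  constructor
  · intro _
    have hC2 : (c₁ / c₂) ≠ 1 := fun h => h₁ ((div_eq_one_iff_eq hc₂).1 h)
    have aux : ∀ a : ℚ, -a / b₁ ∈ ({Bp, Bm} : Set ℚ) →
        ∀ l : ℤ, (-a / b₁) ^ 2 * (c₁ / c₂) ^ l ≠ 1 := by
      intro a ha l
      rcases hcase _ ha with h | h
      · exact absurd (hC ▸ h.1) hC2
      · have := (h 2 two_ne_zero l).1
        rwa [hC, zpow_ofNat] at this
    obtain ⟨m, hm, hbm, hmu⟩ := exists_modulus_forall_not_inMulZb hb hc₁ hc₂ h₁ h₂ hb₁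
      (aux (b₂ + b₃) (by simp [hBp]))
    obtain ⟨m', hm', hbm', hmu'⟩ := exists_modulus_forall_not_inMulZb hb hc₁ hc₂ h₁ h₂ hb₁
      (aux (b₂ - b₃) (by simp [hBm]))
    refine ⟨m * m', by nlinarith, Nat.Coprime.mul_right hbm hbm', fun n hn => ?_⟩
    rw [hu] at hn
    rcases n.even_or_odd with he | ho
    · rw [he.neg_one_zpow, one_mul] at hn
      exact hmu n (inMulZb_of_dvd hn)
    · rw [ho.neg_one_zpow, neg_one_mul, ← sub_eq_add_neg, mul_comm m] at hn
      exact hmu' n (inMulZb_of_dvd hn)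
  · rintro ⟨m, -, -, hm⟩ n hn
    exact hm n ⟨0, 0, by simp [hn]⟩
end
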